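/- If each factor of an aperiodic recurrent infinite word has two or three abelian returns, then the word is Sturmian. -/

import Mathlib

variable {α : Type*}

/-- The factor of the infinite word `w` of length `n` starting at position `i`. -/
def factorAt (w : ℕ → α) (i n : ℕ) : List α :=
  (List.range n).map fun k => w (i + k)

/-- `u` is a factor of the infinite word `w`. -/
def IsFactor (w : ℕ → α) (u : List α) : Prop :=
  ∃ i, factorAt w i u.length = u

/-- `w` is recurrent: each of its factors occurs infinitely many times. -/
def Recurrent (w : ℕ → α) : Prop :=
  ∀ u : List α, IsFactor w u → ∀ N : ℕ, ∃ i, N ≤ i ∧ factorAt w i u.length = u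

/-- `w` is periodic: there is `T > 0` with `w (n + T) = w n` for all `n`. -/
def Periodic (w : ℕ → α) : Prop :=
  ∃ T : ℕ, 0 < T ∧ ∀ n, w (n + T) = w n

def Aperiodic (w : ℕ → α) : Prop := ¬ Periodic w

def UltimatelyPeriodic (w : ℕ → α) : Prop :=
  ∃ N T : ℕ, 0 < T ∧ ∀ n, N ≤ n → w (n + T) = w n

/-- `w` is Sturmian: aperiodic with subword complexity `n + 1`. -/
def Sturmian (w : ℕ → α) : Prop :=
  Aperiodic w ∧ ∀ n : ℕ, {u : List α | u.length = n ∧ IsFactor w u}.ncard = n + 1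

/-- Positions where `u` occurs in `w`. -/
def Occurrences (w : ℕ → α) (u : List α) : Set ℕ :=
  {i | factorAt w i u.length = u}

/-- The return words of `u` in `w`: words from one occurrence of `u` to the next. -/
def ReturnWords (w : ℕ → α) (u : List α) : Set (List α) :=
  {r | ∃ i j : ℕ, i ∈ Occurrences w u ∧ j ∈ Occurrences w u ∧ i < j ∧
    (∀ k, i < k → k < j → k ∉ Occurrences w u) ∧ r = factorAt w i (j - i)}

/-- Positions where a word abelian-equivalent to `u` occurs in `w`. -/
def AbelianOccurrences (w : ℕ → α) (u : List α) : Set ℕ :=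
  {i | List.Perm (factorAt w i u.length) u}

/-- The abelian return words of `u` in `w`. -/
def AbelianReturnWords (w : ℕ → α) (u : List α) : Set (List α) :=
  {r | ∃ i j : ℕ, i ∈ AbelianOccurrences w u ∧ j ∈ AbelianOccurrences w u ∧ i < j ∧
    (∀ k, i < k → k < j → k ∉ AbelianOccurrences w u) ∧ r = factorAt w i (j - i)}

/-- The abelian equivalence classes (as multisets) of the abelian return words of `u` in `w`. -/
def abelianReturnClasses (w : ℕ → α) (u : List α) : Set (Multiset α) :=
  (fun r : List α => (r : Multiset α)) '' AbelianReturnWords w u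

def RightSpecial (w : ℕ → α) (u : List α) : Prop :=
  ∃ a b : α, a ≠ b ∧ IsFactor w (u ++ [a]) ∧ IsFactor w (u ++ [b])

def LeftSpecial (w : ℕ → α) (u : List α) : Prop :=
  ∃ a b : α, a ≠ b ∧ IsFactor w (a :: u) ∧ IsFactor w (b :: u)

def Bispecial (w : ℕ → α) (u : List α) : Prop :=
  RightSpecial w u ∧ LeftSpecial w u

/-- A factor is singular if it is the only factor of `w` in its abelian class. -/
def Singular (w : ℕ → α) (u : List α) : Prop :=
  ∀ v : List α, IsFactor w v → List.Perm v u → v = u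

/-- `w` is an infinite concatenation of words from `S`. -/
def InfConcat (S : Set (List α)) (w : ℕ → α) : Prop :=
  ∃ f : ℕ → List α, (∀ n, f n ∈ S) ∧
    ∀ n, factorAt w (((List.range n).map fun k => (f k).length).sum) (f n).length = f n

/-- A finite binary word is balanced if any two factors of equal length have numbers
of occurrences of `true` differing by at most one. -/
def BalancedList (w : List Bool) : Prop :=
  ∀ u v : List Bool, u <:+: w → v <:+: w → u.length = v.length →
    |(u.count true : ℤ) - (v.count true : ℤ)| ≤ 1

namespace BinWord

/-- Number of ones among the first `n` letters. -/
def pre (f : ℕ → ℤ) (n : ℕ) : ℤ := ∑ k ∈ Finset.range n, f k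

/-- Number of ones in the window of length `N` at position `i`. -/
def win (f : ℕ → ℤ) (N i : ℕ) : ℤ := pre f (i + N) - pre f i

/-- `i + d` is the first position after `i` at which `g` takes the value `g i` again. -/
def Gap {β : Type*} (g : ℕ → β) (i d : ℕ) : Prop :=
  0 < d ∧ g (i + d) = g i ∧ ∀ k, i < k → k < i + d → g k ≠ g i

/-- `i + d` is the first position after `i` whose `N`-window is abelian equivalent
to that at `i`. -/
abbrev IsRet (f : ℕ → ℤ) (N i d : ℕ) : Prop := Gap (win f N) i d

/-- Parikh vectors (length, number of ones) of the abelian returns to the class `(N, c)`. -/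
def retVecs (f : ℕ → ℤ) (N : ℕ) (c : ℤ) : Set (ℕ × ℤ) :=
  {v | ∃ i, IsRet f N i v.1 ∧ win f N i = c ∧ v.2 = pre f (i + v.1) - pre f i}

def UltPer (f : ℕ → ℤ) : Prop := ∃ M T : ℕ, 0 < T ∧ ∀ n, M ≤ n → f (n + T) = f n

/-- Binary recurrent words that are not ultimately periodic and in which every
abelian class has at most three abelian returns. -/
structure Good (f : ℕ → ℤ) : Prop where
  bin : ∀ n, f n = 0 ∨ f n = 1
  ret : ∀ N c, (retVecs f N c).encard ≤ 3
  rec_ : ∀ i n M : ℕ, ∃ j, M ≤ j ∧ ∀ t < n, f (j + t) = f (i + t)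
  not_ultPer : ¬ UltPer f

variable {f : ℕ → ℤ}

lemma pre_zero : pre f 0 = 0 := by simp [pre]

lemma pre_succ (n : ℕ) : pre f (n + 1) = pre f n + f n := by
  simp [pre, Finset.sum_range_succ]

lemma pre_add_const {i k : ℕ} {c : ℤ} (h : ∀ t, i ≤ t → t < i + k → f t = c) :
    pre f (i + k) = pre f i + k * c := by
  induction k with
  | zero => simp
  | succ k ih =>
    rw [← add_assoc, pre_succ, ih fun t h1 h2 => h t h1 (by omega), h (i + k) (by omega) (by omega)]
    push_cast; ring

lemma pre_add_zeros {i k : ℕ} (h : ∀ t, i ≤ t → t < i + k → f t = 0) :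
    pre f (i + k) = pre f i := by
  simpa using pre_add_const h

lemma pre_add_ones {i k : ℕ} (h : ∀ t, i ≤ t → t < i + k → f t = 1) :
    pre f (i + k) = pre f i + k := by
  simpa using pre_add_const h

lemma pre_add_congr {i j : ℕ} {n : ℕ} (h : ∀ t < n, f (j + t) = f (i + t)) :
    ∀ k ≤ n, pre f (j + k) - pre f j = pre f (i + k) - pre f i := by
  intro k
  induction k with
  | zero => simp
  | succ k ih =>
    intro hk
    have := ih (by omega)
    have := h k (by omega)
    rw [← add_assoc, ← add_assoc, pre_succ, pre_succ]
    omega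

lemma win_succ (N i : ℕ) : win f N (i + 1) = win f N i - f i + f (i + N) := by
  have h : i + 1 + N = i + N + 1 := by omega
  simp only [win, h, pre_succ]; ring

lemma win_one (i : ℕ) : win f 1 i = f i := by simp [win, pre_succ]

lemma win_two (i : ℕ) : win f 2 i = f i + f (i + 1) := by
  have : i + 2 = i + 1 + 1 := rfl
  simp [win, this, pre_succ]; ring

lemma win_three (i : ℕ) : win f 3 i = f i + f (i + 1) + f (i + 2) := by
  have : i + 3 = i + 1 + 1 + 1 := rfl
  simp [win, this, pre_succ]; ring

lemma mem_retVecs {N i d : ℕ} {c p : ℤ} (h : IsRet f N i d) (hc : win f N i = c)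
    (hp : pre f (i + d) - pre f i = p) : (d, p) ∈ retVecs f N c :=
  ⟨i, h, hc, hp.symm⟩

lemma eq_of_encard_le_three {α : Type*} {S : Set α} (h : S.encard ≤ 3) {a b c d : α} (ha : a ∈ S)
    (hb : b ∈ S) (hc : c ∈ S) (hd : d ∈ S) :
    a = b ∨ a = c ∨ a = d ∨ b = c ∨ b = d ∨ c = d := by
  by_contra! hne
  obtain ⟨h1, h2, h3, h4, h5, h6⟩ := hne
  have hsub : ({a, b, c, d} : Set α) ⊆ S := by
    rintro x (rfl | rfl | rfl | rfl) <;> assumption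
  have h7 : ({a, b, c, d} : Set α).encard = 4 := by
    rw [Set.encard_insert_of_notMem (by simp [h1, h2, h3]),
      Set.encard_insert_of_notMem (by simp [h4, h5]), Set.encard_pair h6]
    norm_num
  have := (Set.encard_le_encard hsub).trans h
  rw [h7] at this
  exact absurd this (by decide)

/-- A one-letter return. -/
lemma isRet_one {N i : ℕ} (h : f (i + N) = f i) : IsRet f N i 1 :=
  ⟨one_pos, by rw [win_succ, h]; ring, fun k h1 h2 => by omega⟩

lemma one_mem_retVecs {N i : ℕ} {c e : ℤ} (h0 : f i = e) (h : f (i + N) = e)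
    (hc : win f N i = c) : (1, e) ∈ retVecs f N c :=
  mem_retVecs (isRet_one (h.trans h0.symm)) hc (by rw [pre_succ, h0]; ring)

/-- If a class has both one-letter returns, all its other returns are equivalent. -/
lemma Good.ret_unique (hf : Good f) {N i j i' j' d d' : ℕ} {c : ℤ}
    (hi : f i = 0 ∧ f (i + N) = 0 ∧ win f N i = c) (hj : f j = 1 ∧ f (j + N) = 1 ∧ win f N j = c)
    (hr : IsRet f N i' d) (hc : win f N i' = c) (hd : 2 ≤ d)
    (hr' : IsRet f N j' d') (hc' : win f N j' = c) (hd' : 2 ≤ d') : d = d' := by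
  have := eq_of_encard_le_three (hf.ret N c) (one_mem_retVecs hi.1 hi.2.1 hi.2.2)
    (one_mem_retVecs hj.1 hj.2.1 hj.2.2) (mem_retVecs hr hc rfl) (mem_retVecs hr' hc' rfl)
  simp only [Prod.mk.injEq] at this
  omega

lemma Good.exists_win_eq (hf : Good f) (N i M : ℕ) : ∃ j, M ≤ j ∧ win f N j = win f N i := by
  obtain ⟨j, hj, h⟩ := hf.rec_ i N M
  exact ⟨j, hj, pre_add_congr h N le_rfl⟩

lemma exists_gap {β : Type*} {g : ℕ → β} {i : ℕ} (h : ∃ j, i < j ∧ g j = g i) :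
    ∃ d, Gap g i d := by
  classical
  have h : ∃ d, 0 < d ∧ g (i + d) = g i := by
    obtain ⟨j, hj, h⟩ := h
    exact ⟨j - i, by omega, by rw [show i + (j - i) = j by omega, h]⟩
  refine ⟨Nat.find h, (Nat.find_spec h).1, (Nat.find_spec h).2, fun k h1 h2 h3 => ?_⟩
  exact Nat.find_min h (m := k - i) (by omega)
    ⟨by omega, by rw [show i + (k - i) = k by omega, h3]⟩

lemma Good.exists_isRet (hf : Good f) (N i : ℕ) : ∃ d, IsRet f N i d :=
  exists_gap (hf.exists_win_eq N i (i + 1))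

lemma ultPer_of_win (hb : ∀ n, f n = 0 ∨ f n = 1) {N M T : ℕ} (hN : 0 < N) (hT : 0 < T)
    (h : ∀ j, M ≤ j → win f N (j + T) = win f N j) : UltPer f := by
  have hd : ∀ j, M ≤ j → f (j + T + N) - f (j + T) = f (j + N) - f j := by
    intro j hj
    have h1 := h j hj
    have h2 := h (j + 1) (by omega)
    rw [show j + 1 + T = j + T + 1 by omega, win_succ, win_succ, h1] at h2
    linarith
  have hd2 : ∀ k j, M ≤ j → f (j + k * T + N) - f (j + k * T) = f (j + N) - f j := by
    intro k
    induction k with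
    | zero => intro j _; simp
    | succ k ih =>
      intro j hj
      rw [← ih j hj, ← hd (j + k * T) (by nlinarith)]
      rw [show j + (k + 1) * T = j + k * T + T by ring]
  have hD : ∀ k j, M ≤ j → f (j + N * T + k * N) - f (j + N * T) = f (j + k * N) - f j := by
    intro k
    induction k with
    | zero => intro j _; simp
    | succ k ih =>
      intro j hj
      have h1 := ih j hj
      have h2 := hd2 N (j + k * N) (by nlinarith)
      rw [show j + k * N + N * T + N = j + N * T + (k + 1) * N by ring,
        show j + k * N + N * T = j + N * T + k * N by ring,
        show j + k * N + N = j + (k + 1) * N by ring] at h2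
      linarith
  refine ⟨M, N * T, by positivity, fun j hj => ?_⟩
  have h1 := hD T j hj
  rw [show T * N = N * T by ring] at h1
  rcases hb j with h2 | h2 <;> rcases hb (j + N * T) with h3 | h3 <;>
    rcases hb (j + N * T + N * T) with h4 | h4 <;> omega

lemma Good.exists_ne (hf : Good f) (N M : ℕ) (hN : 0 < N) (c : ℤ) :
    ∃ j, M ≤ j ∧ win f N j ≠ c := by
  by_contra! h
  refine hf.not_ultPer (ultPer_of_win (M := M) (T := 1) hf.bin hN one_pos fun j hj => ?_)
  rw [h j hj, h (j + 1) (by omega)]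

lemma exists_drop {β : Type*} {g : ℕ → β} {a b : β} (hab : a ≠ b) (hg : ∀ i, g i = a ∨ g i = b)
    (ha : ∀ M, ∃ i, M ≤ i ∧ g i = a) (hb : ∀ M, ∃ i, M ≤ i ∧ g i = b) (M : ℕ) :
    ∃ i, M ≤ i ∧ g i = b ∧ g (i + 1) = a := by
  by_contra! h
  obtain ⟨i, hi, h1⟩ := hb M
  have h2 : ∀ k, g (i + k) = b := by
    intro k
    induction k with
    | zero => exact h1
    | succ k ih => exact (hg (i + k + 1)).resolve_left (h (i + k) (by omega) ih)
  obtain ⟨j, hj, h3⟩ := ha i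
  exact hab (by simpa [show i + (j - i) = j by omega, h3] using h2 (j - i))

/-- If a sequence takes two values and the lengths of the constant stretches at each value are
constant, then it is ultimately periodic. -/
lemma ultPer_of_gaps {β : Type*} {g : ℕ → β} {a b : β} (hab : a ≠ b) (hg : ∀ i, g i = a ∨ g i = b)
    (ha : ∀ M, ∃ i, M ≤ i ∧ g i = a) (hb : ∀ M, ∃ i, M ≤ i ∧ g i = b) {M r s : ℕ}
    (h0 : ∀ i d, M ≤ i → g i = a → 2 ≤ d → Gap g i d → d = r)
    (h1 : ∀ i d, M ≤ i → g i = b → 2 ≤ d → Gap g i d → d = s) :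
    ∃ L T, 0 < T ∧ ∀ n, L ≤ n → g (n + T) = g n := by
  obtain ⟨i₀, hM, hi1, hi2⟩ := exists_drop hab hg ha hb M
  have hgap : ∀ i, ∃ d, Gap g i d := fun i => by
    rcases hg i with h | h
    · obtain ⟨j, hj, h'⟩ := ha (i + 1); exact exists_gap ⟨j, hj, h'.trans h.symm⟩
    · obtain ⟨j, hj, h'⟩ := hb (i + 1); exact exists_gap ⟨j, hj, h'.trans h.symm⟩
  have key : ∀ i, M ≤ i → g i = b → g (i + 1) = a → 2 ≤ s ∧ 2 ≤ r ∧
      (∀ t, 0 < t → t < s → g (i + t) = a) ∧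
      (∀ t, s ≤ t → t < s + r - 1 → g (i + t) = b) ∧
      g (i + (s + r - 1)) = a := by
    intro i hMi hib hia
    have hgt : ∀ j d, Gap g j d → g (j + 1) ≠ g j → 2 ≤ d := by
      intro j d hd h
      by_contra h2
      obtain rfl : d = 1 := by have := hd.1; omega
      exact h hd.2.1
    obtain ⟨d, hd⟩ := hgap i
    have hd2 := hgt i d hd (by rw [hib, hia]; exact hab)
    obtain rfl := h1 i d hMi hib hd2 hd
    have hlow : ∀ t, 0 < t → t < d → g (i + t) = a := fun t h3 h4 =>
      (hg _).resolve_right (by have := hd.2.2 (i + t) (by omega) (by omega); rwa [hib] at this)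
    have hup := hd.2.1
    rw [hib] at hup
    obtain ⟨e, he⟩ := hgap (i + (d - 1))
    have h5 := hlow (d - 1) (by omega) (by omega)
    have he2 := hgt _ e he (by
      rw [show i + (d - 1) + 1 = i + d by omega, h5, hup]; exact hab.symm)
    obtain rfl := h0 _ e (by omega) h5 he2 he
    refine ⟨hd2, he2, hlow, fun t h3 h4 => ?_, ?_⟩
    · exact (hg _).resolve_left
        (by have := he.2.2 (i + t) (by omega) (by omega); rwa [h5] at this)
    · have := he.2.1
      rw [show i + (d + e - 1) = i + (d - 1) + e by omega, this, h5]
  obtain ⟨hs, hr, -⟩ := key i₀ hM hi1 hi2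
  have hall : ∀ k, g (i₀ + k * (s + r - 2)) = b ∧ g (i₀ + k * (s + r - 2) + 1) = a := by
    intro k
    induction k with
    | zero => simpa using ⟨hi1, hi2⟩
    | succ k ih =>
      obtain ⟨-, -, -, h3, h4⟩ := key _ (by omega) ih.1 ih.2
      have h5 := h3 (s + r - 2) (by omega) (by omega)
      rw [add_mul, one_mul, ← add_assoc]
      refine ⟨h5, ?_⟩
      rw [← h4]; congr 1; omega
  refine ⟨i₀, s + r - 2, by omega, fun j hj => ?_⟩
  have hT : 0 < s + r - 2 := by omega
  have hk := Nat.div_add_mod' (j - i₀) (s + r - 2)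
  have ht := Nat.mod_lt (j - i₀) hT
  generalize (j - i₀) / (s + r - 2) = k at hk
  generalize (j - i₀) % (s + r - 2) = t at hk ht
  have e1 : j = i₀ + k * (s + r - 2) + t := by omega
  have e2 : j + (s + r - 2) = i₀ + (k + 1) * (s + r - 2) + t := by rw [add_mul]; omega
  rw [e2, e1]
  obtain ⟨-, -, a1, a2, -⟩ := key _ (by omega) (hall k).1 (hall k).2
  obtain ⟨-, -, b1, b2, -⟩ := key _ (by omega) (hall (k + 1)).1 (hall (k + 1)).2
  rcases Nat.eq_zero_or_pos t with rfl | h0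
  · simp only [add_zero]; rw [(hall k).1, (hall (k + 1)).1]
  · rcases lt_or_ge t s with h6 | h6
    · rw [a1 t h0 h6, b1 t h0 h6]
    · rw [a2 t h6 (by omega), b2 t h6 (by omega)]

lemma Good.two_level (hf : Good f) {N : ℕ} (hN : 0 < N) {c : ℤ} {r s : ℕ}
    (hc : ∀ i, win f N i = c ∨ win f N i = c + 1)
    (h0 : ∀ i d, win f N i = c → 2 ≤ d → IsRet f N i d → d = r)
    (h1 : ∀ i d, win f N i = c + 1 → 2 ≤ d → IsRet f N i d → d = s) : False := by
  obtain ⟨L, T, hT, h⟩ := ultPer_of_gaps (g := win f N) (a := c) (b := c + 1) (by omega) hc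
    (fun M => (hf.exists_ne N M hN (c + 1)).imp fun i hi => ⟨hi.1, (hc i).resolve_right hi.2⟩)
    (fun M => (hf.exists_ne N M hN c).imp fun i hi => ⟨hi.1, (hc i).resolve_left hi.2⟩)
    (M := 0) (fun i d _ => h0 i d) (fun i d _ => h1 i d)
  exact hf.not_ultPer (ultPer_of_win hf.bin hN hT h)

/-- The word with the two letters exchanged. -/
def flip (f : ℕ → ℤ) (n : ℕ) : ℤ := 1 - f n

lemma flip_flip : flip (flip f) = f := by
  funext n; simp [flip]

lemma pre_flip (n : ℕ) : pre (flip f) n = n - pre f n := by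
  simp [pre, flip, Finset.sum_sub_distrib]

lemma win_flip (N i : ℕ) : win (flip f) N i = N - win f N i := by
  simp only [win, pre_flip]; push_cast; ring

lemma isRet_flip {N i d : ℕ} : IsRet (flip f) N i d ↔ IsRet f N i d := by
  simp [IsRet, Gap, win_flip]

lemma Good.flip (hf : Good f) : Good (flip f) where
  bin n := by have := hf.bin n; simp only [BinWord.flip]; omega
  ret N c := by
    have : retVecs (BinWord.flip f) N c ⊆
        (fun v : ℕ × ℤ => (v.1, v.1 - v.2)) '' retVecs f N (N - c) := by
      rintro ⟨d, q⟩ ⟨i, h1, h2, h3⟩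
      refine ⟨(d, d - q), ⟨i, isRet_flip.1 h1, ?_, ?_⟩, by simp⟩
      · rw [← h2, win_flip]; ring
      · simp only [pre_flip] at h3 ⊢
        rw [h3]; push_cast; ring
    exact (Set.encard_le_encard this).trans ((Set.encard_image_le _ _).trans (hf.ret _ _))
  rec_ i n M := by
    obtain ⟨j, hj, h⟩ := hf.rec_ i n M
    exact ⟨j, hj, fun t ht => by simp [BinWord.flip, h t ht]⟩
  not_ultPer := by
    rintro ⟨M, T, hT, h⟩
    exact hf.not_ultPer ⟨M, T, hT, fun n hn => by have := h n hn; simpa [BinWord.flip] using this⟩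

lemma pre_shift (m n : ℕ) : pre (fun k => f (k + m)) n = pre f (n + m) - pre f m := by
  induction n with
  | zero => simp [pre_zero]
  | succ n ih => rw [pre_succ, ih, show n + 1 + m = n + m + 1 by omega, pre_succ]; ring

lemma win_shift (m N i : ℕ) : win (fun k => f (k + m)) N i = win f N (i + m) := by
  simp only [win, pre_shift]
  rw [show i + N + m = i + m + N by omega]; ring

lemma isRet_shift {m N i d : ℕ} : IsRet (fun k => f (k + m)) N i d ↔ IsRet f N (i + m) d := by
  simp only [IsRet, Gap, win_shift]
  rw [show i + d + m = i + m + d by omega]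
  refine and_congr_right fun _ => and_congr_right fun _ =>
    ⟨fun h k h1 h2 => ?_, fun h k h1 h2 => h _ (by omega) (by omega)⟩
  have := h (k - m) (by omega) (by omega)
  rwa [show k - m + m = k by omega] at this

lemma Good.shift (hf : Good f) (m : ℕ) : Good fun k => f (k + m) where
  bin n := hf.bin _
  ret N c := by
    refine (Set.encard_le_encard ?_).trans (hf.ret N c)
    rintro ⟨d, q⟩ ⟨i, h1, h2, h3⟩
    refine ⟨i + m, isRet_shift.1 h1, ?_, ?_⟩
    · rw [← h2, win_shift]
    · simp only [pre_shift] at h3 ⊢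
      rw [h3, show i + d + m = i + m + d by omega]; ring
  rec_ i n M := by
    obtain ⟨j, hj, h⟩ := hf.rec_ (i + m) n (M + m)
    exact ⟨j - m, by omega, fun t ht => by
      have := h t ht
      rwa [show j + t = j - m + t + m by omega, show i + m + t = i + t + m by omega] at this⟩
  not_ultPer := by
    rintro ⟨M, T, hT, h⟩
    refine hf.not_ultPer ⟨M + m, T, hT, fun n hn => ?_⟩
    have := h (n - m) (by omega)
    simp only at this
    rwa [show n - m + T + m = n + T by omega, show n - m + m = n by omega] at this

/-- A maximal block of `m` zeros starting right after position `i`. -/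
def ZRun (f : ℕ → ℤ) (m i : ℕ) : Prop :=
  1 ≤ m ∧ f i = 1 ∧ (∀ t, i < t → t ≤ i + m → f t = 0) ∧ f (i + m + 1) = 1

/-- A maximal block of `m` ones starting right after position `i`. -/
def ORun (f : ℕ → ℤ) (m i : ℕ) : Prop :=
  1 ≤ m ∧ f i = 0 ∧ (∀ t, i < t → t ≤ i + m → f t = 1) ∧ f (i + m + 1) = 0

lemma zRun_flip {m i : ℕ} : ZRun (flip f) m i ↔ ORun f m i := by
  simp only [ZRun, ORun, flip]
  constructor
  · rintro ⟨h1, h2, h3, h4⟩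
    exact ⟨h1, by omega, fun t a b => by have := h3 t a b; omega, by omega⟩
  · rintro ⟨h1, h2, h3, h4⟩
    exact ⟨h1, by omega, fun t a b => by have := h3 t a b; omega, by omega⟩

lemma oRun_flip {m i : ℕ} : ORun (flip f) m i ↔ ZRun f m i := by
  rw [← zRun_flip, flip_flip]

lemma Good.exists_eq (hf : Good f) (M : ℕ) {c : ℤ} (hc : c = 0 ∨ c = 1) : ∃ i, M ≤ i ∧ f i = c := by
  obtain ⟨i, hi, h⟩ := hf.exists_ne 1 M one_pos (1 - c)
  rw [win_one] at h
  exact ⟨i, hi, by have := hf.bin i; omega⟩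

lemma Good.exists_change (hf : Good f) (M : ℕ) {c : ℤ} (hc : c = 0 ∨ c = 1) :
    ∃ i, M ≤ i ∧ f i = c ∧ f (i + 1) = 1 - c :=
  exists_drop (by omega) (fun i => by have := hf.bin i; omega)
    (fun M => hf.exists_eq M (by omega)) (fun M => hf.exists_eq M hc) M

/-- Every change of letter starts a complete run. -/
lemma Good.exists_zRun_at (hf : Good f) {i : ℕ} (h0 : f i = 1) (h1 : f (i + 1) = 0) :
    ∃ m, ZRun f m i := by
  obtain ⟨j, hj, h⟩ := hf.exists_eq (i + 1) (c := 1) (by omega)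
  obtain ⟨d, hd, hd1, hd2⟩ := exists_gap (g := f) (i := i) ⟨j, by omega, h.trans h0.symm⟩
  have hd3 : d ≠ 1 := by rintro rfl; omega
  refine ⟨d - 1, by omega, h0, fun t ht ht' => ?_, ?_⟩
  · have := hd2 t ht (by omega); have := hf.bin t; omega
  · rw [show i + (d - 1) + 1 = i + d by omega, hd1, h0]

lemma Good.exists_oRun_at (hf : Good f) {i : ℕ} (h0 : f i = 0) (h1 : f (i + 1) = 1) :
    ∃ m, ORun f m i := by
  obtain ⟨m, hm⟩ := hf.flip.exists_zRun_at (i := i) (by simp [BinWord.flip, h0])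
    (by simp [BinWord.flip, h1])
  exact ⟨m, zRun_flip.1 hm⟩

lemma Good.zRun_rec (hf : Good f) {m i : ℕ} (h : ZRun f m i) (M : ℕ) : ∃ j, M ≤ j ∧ ZRun f m j := by
  obtain ⟨j, hj, hr⟩ := hf.rec_ i (m + 2) M
  obtain ⟨h1, h2, h3, h4⟩ := h
  refine ⟨j, hj, h1, ?_, fun t ht ht' => ?_, ?_⟩
  · have := hr 0 (by omega); simp only [add_zero] at this; omega
  · have := hr (t - j) (by omega)
    rwa [show j + (t - j) = t by omega, h3 (i + (t - j)) (by omega) (by omega)] at this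
  · have := hr (m + 1) (by omega)
    rw [← add_assoc, ← add_assoc] at this; omega

lemma Good.oRun_rec (hf : Good f) {m i : ℕ} (h : ORun f m i) (M : ℕ) : ∃ j, M ≤ j ∧ ORun f m j := by
  obtain ⟨j, hj, hr⟩ := hf.flip.zRun_rec (zRun_flip.2 h) M
  exact ⟨j, hj, zRun_flip.1 hr⟩

lemma ZRun.mem_one {m i : ℕ} (h : ZRun f m i) : (m + 1, (1 : ℤ)) ∈ retVecs f 1 1 := by
  obtain ⟨h1, h2, h3, h4⟩ := h
  refine mem_retVecs (i := i) ⟨by omega, ?_, fun k hk hk' => ?_⟩ (by rw [win_one, h2]) ?_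
  · rw [win_one, win_one, h2, ← add_assoc, h4]
  · rw [win_one, win_one, h2, h3 k hk (by omega)]; decide
  · have := pre_add_zeros (f := f) (i := i + 1) (k := m) fun t a b => h3 t (by omega) (by omega)
    rw [show i + 1 + m = i + (m + 1) by omega, pre_succ] at this
    omega

lemma ZRun.mem_two {m i : ℕ} (h : ZRun f m i) : (m, (1 : ℤ)) ∈ retVecs f 2 1 := by
  obtain ⟨h1, h2, h3, h4⟩ := h
  have h5 := h3 (i + 1) (by omega) (by omega)
  have h6 := h3 (i + m) (by omega) (by omega)
  have h7 : win f 2 i = 1 := by rw [win_two, h2, h5]; rfl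
  refine mem_retVecs (i := i) ⟨by omega, ?_, fun k hk hk' => ?_⟩ h7 ?_
  · rw [h7, win_two, h6, h4]; rfl
  · rw [h7, win_two, h3 k hk (by omega), h3 (k + 1) (by omega) (by omega)]; decide
  · have := pre_add_zeros (f := f) (i := i + 1) (k := m - 1) fun t a b => h3 t (by omega) (by omega)
    rw [show i + 1 + (m - 1) = i + m by omega, pre_succ] at this
    omega

lemma ORun.mem_two {m i : ℕ} (h : ORun f m i) : (m, (m : ℤ) - 1) ∈ retVecs f 2 1 := by
  obtain ⟨h1, h2, h3, h4⟩ := h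
  have h5 := h3 (i + 1) (by omega) (by omega)
  have h6 := h3 (i + m) (by omega) (by omega)
  have h7 : win f 2 i = 1 := by rw [win_two, h2, h5]; rfl
  refine mem_retVecs (i := i) ⟨by omega, ?_, fun k hk hk' => ?_⟩ h7 ?_
  · rw [h7, win_two, h6, h4]; rfl
  · rw [h7, win_two, h3 k hk (by omega), h3 (k + 1) (by omega) (by omega)]; decide
  · have := pre_add_ones (f := f) (i := i + 1) (k := m - 1) fun t a b => h3 t (by omega) (by omega)
    rw [show i + 1 + (m - 1) = i + m by omega, pre_succ] at this
    push_cast [h1] at this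
    omega

lemma ORun.mem_one_one {m i : ℕ} (h : ORun f m i) (hm : 2 ≤ m) : (1, (1 : ℤ)) ∈ retVecs f 1 1 := by
  obtain ⟨h1, h2, h3, h4⟩ := h
  have h5 := h3 (i + 1) (by omega) (by omega)
  exact one_mem_retVecs (i := i + 1) h5 (h3 (i + 1 + 1) (by omega) (by omega))
    (by rw [win_one, h5])

lemma Good.exists_zRun (hf : Good f) : ∃ m i, ZRun f m i := by
  obtain ⟨i, -, h1, h2⟩ := hf.exists_change 0 (c := 1) (by omega)
  obtain ⟨m, hm⟩ := hf.exists_zRun_at h1 (by omega)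
  exact ⟨m, i, hm⟩

lemma Good.exists_oRun (hf : Good f) : ∃ m i, ORun f m i := by
  obtain ⟨m, i, h⟩ := hf.flip.exists_zRun
  exact ⟨m, i, zRun_flip.1 h⟩

lemma Good.zRun_three (hf : Good f) {a b c i j k : ℕ} (ha : ZRun f a i) (hb : ZRun f b j)
    (hc : ZRun f c k) : a = b ∨ a = c ∨ b = c := by
  obtain ⟨x, y, hx⟩ := hf.exists_oRun
  have h1 := eq_of_encard_le_three (hf.ret 2 1) ha.mem_two hb.mem_two hc.mem_two hx.mem_two
  have h2 := fun h => eq_of_encard_le_three (hf.ret 1 1) ha.mem_one hb.mem_one hc.mem_one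
    (hx.mem_one_one h)
  have := ha.1
  have := hb.1
  have := hc.1
  simp only [Prod.mk.injEq] at h1 h2
  omega

lemma exists_pair_of_three {p : ℕ → Prop} (hne : ∃ a, p a)
    (h : ∀ a b c, p a → p b → p c → a = b ∨ a = c ∨ b = c) :
    ∃ m l, m ≤ l ∧ p m ∧ p l ∧ ∀ x, p x → x = m ∨ x = l := by
  obtain ⟨a, ha⟩ := hne
  by_cases h1 : ∀ x, p x → x = a
  · exact ⟨a, a, le_rfl, ha, ha, fun x hx => .inl (h1 x hx)⟩
  · push Not at h1
    obtain ⟨b, hb, hab⟩ := h1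
    have h2 : ∀ x, p x → x = a ∨ x = b := fun x hx => by have := h x a b hx ha hb; omega
    rcases le_total a b with h3 | h3
    · exact ⟨a, b, h3, ha, hb, h2⟩
    · exact ⟨b, a, h3, hb, ha, fun x hx => (h2 x hx).symm⟩

/-- All maximal blocks of ones have length `j`, and the maximal blocks of zeros have the two
lengths `m < l`. -/
structure OneRun (f : ℕ → ℤ) (j m l : ℕ) : Prop where
  lt : m < l
  ones : ∀ x i, ORun f x i → x = j
  zeros : ∀ x i, ZRun f x i → x = m ∨ x = l
  left : ∃ i, ZRun f m i
  right : ∃ i, ZRun f l i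

/-- The maximal blocks of zeros have lengths `2` and `m ≠ 2`, the maximal blocks of ones
`2` and `k ≠ 2`. -/
structure TwoRun (f : ℕ → ℤ) (m k : ℕ) : Prop where
  m_ne : m ≠ 2
  k_ne : k ≠ 2
  zeros : ∀ x i, ZRun f x i → x = 2 ∨ x = m
  ones : ∀ x i, ORun f x i → x = 2 ∨ x = k
  z_two : ∃ i, ZRun f 2 i
  z_m : ∃ i, ZRun f m i
  o_two : ∃ i, ORun f 2 i
  o_k : ∃ i, ORun f k i

lemma Good.run_cases (hf : Good f) :
    (∃ j m l, OneRun f j m l) ∨ (∃ j m l, OneRun (BinWord.flip f) j m l) ∨ ∃ m k, TwoRun f m k := by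
  obtain ⟨m, l, hml, hm, hl, hz⟩ := exists_pair_of_three hf.exists_zRun
    fun a b c ⟨i, hi⟩ ⟨j, hj⟩ ⟨k, hk⟩ => hf.zRun_three hi hj hk
  obtain ⟨j, k, hjk, hj, hk, ho⟩ := exists_pair_of_three hf.exists_oRun
    fun a b c ⟨i, hi⟩ ⟨j, hj⟩ ⟨k, hk⟩ =>
      hf.flip.zRun_three (zRun_flip.2 hi) (zRun_flip.2 hj) (zRun_flip.2 hk)
  rcases hjk.eq_or_lt with rfl | hjk'
  · rcases hml.eq_or_lt with rfl | hml'
    · exfalso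
      refine hf.not_ultPer ?_
      have h0 : ∀ i d, 0 ≤ i → f i = 0 → 2 ≤ d → Gap f i d → d = j + 1 := by
        rintro i d - h1 h2 ⟨h3, h4, h5⟩
        have h6 : ORun f (d - 1) i := ⟨by omega, h1, fun t ht ht' => by
          have := h5 t ht (by omega); have := hf.bin t; omega,
          by rw [show i + (d - 1) + 1 = i + d by omega, h4, h1]⟩
        have := ho _ ⟨i, h6⟩
        omega
      have h1 : ∀ i d, 0 ≤ i → f i = 1 → 2 ≤ d → Gap f i d → d = m + 1 := by
        rintro i d - h1 h2 ⟨h3, h4, h5⟩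
        have h6 : ZRun f (d - 1) i := ⟨by omega, h1, fun t ht ht' => by
          have := h5 t ht (by omega); have := hf.bin t; omega,
          by rw [show i + (d - 1) + 1 = i + d by omega, h4, h1]⟩
        have := hz _ ⟨i, h6⟩
        omega
      exact ultPer_of_gaps (by decide) hf.bin
        (fun M => hf.exists_eq M (by omega)) (fun M => hf.exists_eq M (by omega)) h0 h1
    · exact .inl ⟨j, m, l, hml', fun x i h => by have := ho x ⟨i, h⟩; omega,
        fun x i h => hz x ⟨i, h⟩, hm, hl⟩
  · rcases hml.eq_or_lt with rfl | hml'
    · exact .inr (.inl ⟨m, j, k, hjk', fun x i h => by have := hz x ⟨i, oRun_flip.1 h⟩; omega,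
        fun x i h => ho x ⟨i, zRun_flip.1 h⟩, hj.imp fun _ => zRun_flip.2,
        hk.imp fun _ => zRun_flip.2⟩)
    · obtain ⟨_, h1⟩ := hm
      obtain ⟨_, h2⟩ := hl
      obtain ⟨_, h3⟩ := hj
      obtain ⟨_, h4⟩ := hk
      have := eq_of_encard_le_three (hf.ret 2 1) h1.mem_two h2.mem_two h3.mem_two h4.mem_two
      simp only [Prod.mk.injEq] at this
      have h5 : (m = 2 ∨ l = 2) ∧ (j = 2 ∨ k = 2) := by omega
      refine .inr (.inr ?_)
      rcases h5 with ⟨rfl | rfl, rfl | rfl⟩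
      · exact ⟨l, k, by omega, by omega, fun x i h => hz x ⟨i, h⟩, fun x i h => ho x ⟨i, h⟩,
          ⟨_, h1⟩, ⟨_, h2⟩, ⟨_, h3⟩, ⟨_, h4⟩⟩
      · exact ⟨l, j, by omega, by omega, fun x i h => hz x ⟨i, h⟩, fun x i h => (ho x ⟨i, h⟩).symm,
          ⟨_, h1⟩, ⟨_, h2⟩, ⟨_, h4⟩, ⟨_, h3⟩⟩
      · exact ⟨m, k, by omega, by omega, fun x i h => (hz x ⟨i, h⟩).symm, fun x i h => ho x ⟨i, h⟩,
          ⟨_, h2⟩, ⟨_, h1⟩, ⟨_, h3⟩, ⟨_, h4⟩⟩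
      · exact ⟨m, j, by omega, by omega, fun x i h => (hz x ⟨i, h⟩).symm,
          fun x i h => (ho x ⟨i, h⟩).symm, ⟨_, h2⟩, ⟨_, h1⟩, ⟨_, h4⟩, ⟨_, h3⟩⟩

/-- Decomposition of `f`, from position `p 0` on, into blocks: `y i` zeros starting at `p i`
followed by `j` ones. -/
structure Blocks (f : ℕ → ℤ) (j : ℕ) (p y : ℕ → ℕ) : Prop where
  pos : 1 ≤ j
  y_pos : ∀ i, 1 ≤ y i
  p_zero : p 0 = 1
  pre_one : pre f 1 = 1
  step : ∀ i, p (i + 1) = p i + y i + j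
  zero : ∀ i t, t < y i → f (p i + t) = 0
  one : ∀ i t, t < j → f (p i + y i + t) = 1

lemma Good.exists_blocks (hf : Good f) {j m l : ℕ} (h : OneRun f j m l) :
    ∃ s p y, Blocks (fun n => f (n + s)) j p y ∧ ∀ i, y i = m ∨ y i = l := by
  obtain ⟨s, -, hs0, hs1⟩ := hf.exists_change 0 (c := 1) (by omega)
  have key : ∀ q, f (q + s) = 1 → f (q + 1 + s) = 0 → ∃ y, (y = m ∨ y = l) ∧ 1 ≤ y ∧ 1 ≤ j ∧
      (∀ t < y, f (q + 1 + t + s) = 0) ∧ (∀ t < j, f (q + 1 + y + t + s) = 1) ∧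
      f (q + 1 + y + j + s) = 0 := by
    intro q h0 h1
    obtain ⟨y, hy⟩ := hf.exists_zRun_at h0 (by rwa [show q + s + 1 = q + 1 + s by omega])
    have hym := h.zeros _ _ hy
    obtain ⟨a1, a2, a3, a4⟩ := hy
    obtain ⟨x, hx⟩ := hf.exists_oRun_at (i := q + s + y) (a3 _ (by omega) (by omega)) a4
    obtain rfl := h.ones _ _ hx
    obtain ⟨b1, b2, b3, b4⟩ := hx
    refine ⟨y, hym, a1, b1, fun t ht => a3 _ (by omega) (by omega),
      fun t ht => b3 _ (by omega) (by omega), ?_⟩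
    rw [← b4]; congr 1; omega
  have : ∀ q : {q // f (q + s) = 1 ∧ f (q + 1 + s) = 0},
      ∃ q' : {q // f (q + s) = 1 ∧ f (q + 1 + s) = 0},
      ∃ y, (y = m ∨ y = l) ∧ 1 ≤ y ∧ 1 ≤ j ∧ (∀ t < y, f (q + 1 + t + s) = 0) ∧
      (∀ t < j, f (q + 1 + y + t + s) = 1) ∧ (q' : ℕ) = q + y + j := by
    rintro ⟨q, h0, h1⟩
    obtain ⟨y, c1, c2, c3, c4, c5, c6⟩ := key q h0 h1
    refine ⟨⟨q + y + j, ?_, ?_⟩, y, c1, c2, c3, c4, c5, rfl⟩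
    · have := c5 (j - 1) (by omega)
      rw [← this]; congr 1; omega
    · rw [← c6]; congr 1; omega
  choose nxt yy d1 d2 d3 d4 d5 d6 using this
  let q : ℕ → {q // f (q + s) = 1 ∧ f (q + 1 + s) = 0} := fun n => n.rec
    ⟨0, by simpa using hs0, by simpa [add_comm] using hs1⟩ fun _ x => nxt x
  let P : ℕ → ℕ := fun i => (q i).1 + 1
  refine ⟨s, P, fun i => yy (q i), ⟨d3 (q 0), fun i => d2 _, rfl, ?_, fun i => ?_,
    fun i => d4 (q i), fun i => d5 (q i)⟩, fun i => d1 _⟩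
  · simpa [pre] using hs0
  · have := d6 (q i)
    change (nxt (q i) : ℕ) + 1 = (q i).1 + 1 + yy (q i) + j
    omega

section Blocks

variable {j : ℕ} {p y : ℕ → ℕ}

lemma pre_mono (hb : ∀ n, f n = 0 ∨ f n = 1) {a b : ℕ} (h : a ≤ b) : pre f a ≤ pre f b := by
  induction b, h using Nat.le_induction with
  | base => rfl
  | succ b _ ih => rw [pre_succ]; have := hb b; omega

lemma Blocks.pre_zeros (hB : Blocks f j p y) (i : ℕ) ⦃t : ℕ⦄ (ht : t ≤ y i) :
    pre f (p i + t) = pre f (p i) :=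
  pre_add_zeros fun n h1 h2 => by
    have := hB.zero i (n - p i) (by omega)
    rwa [show p i + (n - p i) = n by omega] at this

lemma Blocks.pre_ones (hB : Blocks f j p y) (i : ℕ) ⦃t : ℕ⦄ (ht : t ≤ j) :
    pre f (p i + y i + t) = pre f (p i) + t := by
  rw [← hB.pre_zeros i le_rfl]
  exact pre_add_ones fun n h1 h2 => by
    have := hB.one i (n - (p i + y i)) (by omega)
    rwa [show p i + y i + (n - (p i + y i)) = n by omega] at this

lemma Blocks.pre_p_succ (hB : Blocks f j p y) (i : ℕ) : pre f (p (i + 1)) = pre f (p i) + j := by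
  rw [hB.step, hB.pre_ones i le_rfl]

lemma Blocks.pre_p (hB : Blocks f j p y) (i : ℕ) : pre f (p i) = 1 + i * j := by
  induction i with
  | zero => rw [hB.p_zero, hB.pre_one]; simp
  | succ i ih => rw [hB.pre_p_succ, ih]; push_cast; ring

lemma Blocks.pre_le_iff (hB : Blocks f j p y) (hb : ∀ n, f n = 0 ∨ f n = 1) (i n : ℕ) ⦃t : ℕ⦄
    (ht : t < j) ⦃v : ℤ⦄ (hv : v = pre f (p i) + t) : pre f n ≤ v ↔ n ≤ p i + y i + t := by
  have h1 := hB.pre_ones i ht.le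
  have h2 := hB.pre_ones i (t := t + 1) ht
  constructor
  · intro h
    by_contra! h3
    have := pre_mono hb (a := p i + y i + (t + 1)) (b := n) h3
    push_cast at h2
    omega
  · intro h
    have := pre_mono hb h
    omega

lemma Blocks.p_strict (hB : Blocks f j p y) {a b : ℕ} (h : a < b) : p a < p b := by
  have : StrictMono p := strictMono_nat_of_lt_succ fun n => by
    have := hB.step n; have := hB.pos; omega
  exact this h

/-- Consecutive occurrences, `g` apart, of the event `I`. -/
def PGap (I : ℕ → Prop) (i g : ℕ) : Prop :=
  1 ≤ i ∧ 0 < g ∧ I i ∧ I (i + g) ∧ ∀ k, i < k → k < i + g → ¬ I k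

/-- The gaps between consecutive occurrences of `I`, measured by number of blocks and by length,
take at most two values. -/
def TwoGaps (p : ℕ → ℕ) (I : ℕ → Prop) : Prop :=
  ∀ i₁ g₁ i₂ g₂ i₃ g₃, PGap I i₁ g₁ → PGap I i₂ g₂ → PGap I i₃ g₃ →
    (g₁ = g₂ ∧ p (i₁ + g₁) + p i₂ = p (i₂ + g₂) + p i₁) ∨
    (g₁ = g₃ ∧ p (i₁ + g₁) + p i₃ = p (i₃ + g₃) + p i₁) ∨
    (g₂ = g₃ ∧ p (i₂ + g₂) + p i₃ = p (i₃ + g₃) + p i₂)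

/-- If the occurrences of a class form stretches of equal letters, at positions given by
the event `I`, then `I` has few gaps. -/
lemma Good.twoGaps (hf : Good f) (hj : j ≠ 0) {A : ℕ → ℕ} {I : ℕ → Prop} {b N x z : ℕ} {e c C : ℤ}
    (hAp : ∀ i, 1 ≤ i → A i + x = p i + z) (hAP : ∀ i, 1 ≤ i → pre f (A i) = i * j + C)
    (hAe : ∀ i, 1 ≤ i → ∀ t < b, f (A i + t) = e) (hb : 1 ≤ b)
    (hlt : ∀ i, 1 ≤ i → A i + b < A (i + 1))
    (hocc : ∀ i n, 1 ≤ i → A i ≤ n → n < A (i + 1) → (win f N n = c ↔ I i ∧ n ≤ A i + b))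
    (hne : ∀ i g, 1 ≤ i → 1 ≤ g → p (i + g) = p i + b + 1 → (g : ℤ) * j ≠ (b + 1) * e) :
    TwoGaps p I := by
  have hmono : ∀ i g, 1 ≤ i → 1 ≤ g → A i + b < A (i + g) := by
    intro i g hi hg
    induction g, hg using Nat.le_induction with
    | base => exact hlt i hi
    | succ g _ ih => have := hlt (i + g) (by omega); rw [← add_assoc]; omega
  have hfind : ∀ i g n, 1 ≤ i → A i ≤ n → n < A (i + g) → ∃ k, i ≤ k ∧ k < i + g ∧ A k ≤ n ∧
      n < A (k + 1) := by
    intro i g n hi h1 h2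
    induction g with
    | zero => exact absurd h2 (by simpa using h1)
    | succ g ih =>
      by_cases h3 : n < A (i + g)
      · obtain ⟨k, hk⟩ := ih h3
        exact ⟨k, hk.1, by omega, hk.2.2⟩
      · exact ⟨i + g, by omega, by omega, by omega, h2⟩
  have hmem : ∀ i g, PGap I i g →
      (A (i + g) - (A i + b), (g : ℤ) * j - b * e) ∈ retVecs f N c := by
    rintro i g ⟨h1, h2, h3, h4, h5⟩
    have h6 := hmono i g h1 h2
    have hi : win f N (A i + b) = c := (hocc i _ h1 (by omega) (hlt i h1)).2 ⟨h3, le_rfl⟩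
    refine mem_retVecs (i := A i + b) ⟨by omega, ?_, fun n hn hn' => ?_⟩ hi ?_
    · rw [hi, show A i + b + (A (i + g) - (A i + b)) = A (i + g) by omega]
      exact (hocc (i + g) _ (by omega) le_rfl (by have := hlt (i + g) (by omega); omega)).2
        ⟨h4, by omega⟩
    · rw [hi]
      obtain ⟨k, k1, k2, k3, k4⟩ := hfind i g n h1 (by omega) (by omega)
      rw [Ne, hocc k n (by omega) k3 k4]
      rintro ⟨h7, h8⟩
      rcases k1.eq_or_lt with rfl | k5
      · omega
      · exact h5 k k5 k2 h7
    · rw [show A i + b + (A (i + g) - (A i + b)) = A (i + g) by omega, hAP _ (by omega),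
        pre_add_const (c := e) fun t t1 t2 => ?_, hAP i h1]
      · push_cast; ring
      · have := hAe i h1 (t - A i) (by omega)
        rwa [show A i + (t - A i) = t by omega] at this
  have hone : ∀ i g, PGap I i g → (1, e) ∈ retVecs f N c := by
    rintro i g ⟨h1, h2, h3, -⟩
    have h4 := hlt i h1
    have h5 := (hocc i (A i) h1 le_rfl (by omega)).2 ⟨h3, by omega⟩
    have h6 := (hocc i (A i + 1) h1 (by omega) (by omega)).2 ⟨h3, by omega⟩
    have h7 := hAe i h1 0 hb
    exact mem_retVecs ⟨one_pos, h6.trans h5.symm, fun k _ _ => by omega⟩ h5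
      (by rw [pre_succ]; simpa using h7)
  have hne' : ∀ i g, PGap I i g → (1, e) ≠ (A (i + g) - (A i + b), (g : ℤ) * j - b * e) := by
    rintro i g ⟨h1, h2, -⟩ h
    simp only [Prod.mk.injEq] at h
    have h3 := hAp i h1
    have h4 := hAp (i + g) (by omega)
    exact hne i g h1 h2 (by omega) (by linarith [h.2])
  intro i₁ g₁ i₂ g₂ i₃ g₃ h₁ h₂ h₃
  have hco : ∀ i g i' g', PGap I i g → PGap I i' g' →
      (A (i + g) - (A i + b), (g : ℤ) * j - b * e) =
      (A (i' + g') - (A i' + b), (g' : ℤ) * j - b * e) →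
      g = g' ∧ p (i + g) + p i' = p (i' + g') + p i := by
    rintro i g i' g' ⟨h1, h2, -⟩ ⟨h1', h2', -⟩ h
    simp only [Prod.mk.injEq] at h
    have e1 := hAp i h1
    have e2 := hAp (i + g) (by omega)
    have e3 := hAp i' h1'
    have e4 := hAp (i' + g') (by omega)
    have e5 := hmono i g h1 h2
    have e6 := hmono i' g' h1' h2'
    refine ⟨?_, by omega⟩
    have : (g : ℤ) * j = g' * j := by linarith [h.2]
    have := mul_right_cancel₀ (by exact_mod_cast hj) this
    exact_mod_cast this
  have h4 := eq_of_encard_le_three (hf.ret N c) (hone _ _ h₁) (hmem _ _ h₁) (hmem _ _ h₂)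
    (hmem _ _ h₃)
  rcases h4 with h | h | h | h | h | h
  · exact absurd h (hne' _ _ h₁)
  · exact absurd h (hne' _ _ h₂)
  · exact absurd h (hne' _ _ h₃)
  · exact .inl (hco _ _ _ _ h₁ h₂ h)
  · exact .inr (.inl (hco _ _ _ _ h₁ h₃ h))
  · exact .inr (.inr (hco _ _ _ _ h₂ h₃ h))

lemma Blocks.pre_p_add (hB : Blocks f j p y) (i r : ℕ) :
    pre f (p (i + r)) = pre f (p i) + r * j := by
  rw [hB.pre_p, hB.pre_p]; push_cast; ring

lemma win_eq_iff {N n : ℕ} {c : ℤ} :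
    win f N n = c ↔ pre f (n + N) ≤ pre f n + c ∧ ¬ pre f (n + N) ≤ pre f n + c - 1 := by
  simp only [win]; omega

lemma Good.twoGaps_min (hf : Good f) (hB : Blocks f j p y) (hj : 2 ≤ j) {r X : ℕ}
    (hX : ∀ i, 1 ≤ i → p i + X + r * j ≤ p (i + r)) :
    TwoGaps p fun i => p (i + r) = p i + X + r * j := by
  have hs : ∀ i, 1 ≤ i → p i = p (i - 1) + y (i - 1) + j := fun i hi => by
    rw [← hB.step, Nat.sub_add_cancel hi]
  have hP : ∀ i, 1 ≤ i → pre f (p i) = pre f (p (i - 1)) + j := fun i hi => by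
    rw [← hB.pre_p_succ, Nat.sub_add_cancel hi]
  refine hf.twoGaps (j := j) (by omega) (A := fun i => p i - j) (b := j - 1)
    (N := X + r * j + 1) (x := j)
    (z := 0) (e := 1) (c := r * j + 1) (C := 1 - j) (fun i hi => ?_) (fun i hi => ?_)
    (fun i hi t ht => ?_) (by omega) (fun i hi => ?_) (fun i n hi h1 h2 => ?_)
    (fun i g hi hg h => ?_)
  · have := hs i hi; omega
  · have h1 := hs i hi
    have h2 := hB.pre_zeros (i - 1) le_rfl
    have h3 := hB.pre_p i
    have h4 := hP i hi
    rw [show p i - j = p (i - 1) + y (i - 1) by omega, h2]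
    linarith
  · have h1 := hs i hi
    have := hB.one (i - 1) t (by omega)
    rwa [show p i - j + t = p (i - 1) + y (i - 1) + t by omega]
  · have h1 := hs i hi
    have := hB.step i
    have := hB.y_pos i
    omega
  · have h0 := hX i hi
    have h0' := hX (i + 1) (by omega)
    have e1 := hs i hi
    have e2 := hB.step i
    have e3 := hB.step (i + r)
    have e4 := hs (i + r) (by omega)
    rw [show i + 1 + r = i + r + 1 by omega] at h0'
    have P1 := hB.pre_p_add i r
    have P2 := hP i hi
    have P3 := hP (i + r) (by omega)
    have P4 := hB.pre_le_iff hf.bin (i + r) (n + (X + r * j + 1))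
    have P5 := hB.pre_le_iff hf.bin (i + r - 1) (n + (X + r * j + 1))
    have P6 := hB.pre_ones (i - 1)
    have P7 := hB.pre_zeros i
    rw [win_eq_iff]
    have y0 := hB.y_pos (i + r)
    have hR : ((r * j : ℕ) : ℤ) = r * j := by push_cast; ring
    generalize r * j = R at *
    rw [← hR] at P1 ⊢
    clear hX hs hP
    have hle : n ≤ p i - j + (j - 1) ↔ n < p i := by clear P4 P5 P6 P7; omega
    replace h1 : p (i - 1) + y (i - 1) ≤ n := by clear P4 P5 P6 P7; omega
    replace h2 : n < p i + y i := by clear P4 P5 P6 P7; omega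
    rw [hle]
    clear hle
    rcases lt_or_ge n (p i) with h3 | h3
    · obtain ⟨t, rfl⟩ := Nat.exists_eq_add_of_le h1
      have P6 := P6 (t := t) (by omega)
      rcases eq_or_ne (t + 1) j with h4 | h4
      · rw [P4 (t := 0) (by omega) (by omega), P5 (t := t) (by omega) (by omega)]
        clear P1 P2 P3 P4 P5 P6 P7
        omega
      · rw [P5 (t := t + 1) (by omega) (by push_cast; omega),
          P5 (t := t) (by omega) (by omega)]
        clear P1 P2 P3 P4 P5 P6 P7
        omega
    · obtain ⟨t, rfl⟩ := Nat.exists_eq_add_of_le h3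
      have P7 := P7 (t := t) (by omega)
      rw [P4 (t := 1) (by omega) (by push_cast; omega), P4 (t := 0) (by omega) (by omega)]
      clear P1 P2 P3 P4 P5 P6 P7
      omega
  · have h1 := hB.step i
    have h2 := hB.y_pos i
    have h3 : p (i + 1) ≤ p (i + g) := by
      rcases hg.eq_or_lt with rfl | h4
      · rfl
      · exact (hB.p_strict (by omega)).le
    omega

lemma Good.twoGaps_max (hf : Good f) (hB : Blocks f j p y) (hj : 2 ≤ j) {r X : ℕ} (hr : 1 ≤ r)
    (hX : ∀ i, 1 ≤ i → p (i + r) ≤ p i + X + r * j) :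
    TwoGaps p fun i => p (i + r) = p i + X + r * j := by
  have hp : ∀ i, 1 ≤ p i := fun i => by
    have := hB.p_zero
    rcases Nat.eq_zero_or_pos i with rfl | h
    · omega
    · have := hB.p_strict h; omega
  have hs : ∀ i, 1 ≤ i → p i = p (i - 1) + y (i - 1) + j := fun i hi => by
    rw [← hB.step, Nat.sub_add_cancel hi]
  have hP : ∀ i, 1 ≤ i → pre f (p i) = pre f (p (i - 1)) + j := fun i hi => by
    rw [← hB.pre_p_succ, Nat.sub_add_cancel hi]
  have hrj : r * j = (r - 1) * j + j := by
    obtain ⟨r, rfl⟩ := Nat.exists_eq_add_of_le' hr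
    simp; ring
  refine hf.twoGaps (j := j) (by omega) (A := fun i => p i - 1) (b := 1)
    (N := X + (r - 1) * j + 1) (x := 1)
    (z := 0) (e := 1) (c := ((r - 1) * j : ℕ) + 1) (C := 0) (fun i hi => ?_) (fun i hi => ?_)
    (fun i hi t ht => ?_) (by omega) (fun i hi => ?_) (fun i n hi h1 h2 => ?_)
    (fun i g hi hg h => ?_)
  · have := hp i; omega
  · have h1 := hs i hi
    have h2 := hB.pre_ones (i - 1) (t := j - 1) (by omega)
    have h3 := hB.pre_p i
    have h4 := hP i hi
    rw [show p i - 1 = p (i - 1) + y (i - 1) + (j - 1) by omega, h2]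
    push_cast [show 1 ≤ j by omega]
    linarith
  · have h1 := hs i hi
    have := hB.one (i - 1) (j - 1) (by omega)
    rwa [show p i - 1 + t = p (i - 1) + y (i - 1) + (j - 1) by omega]
  · have := hB.step i
    have := hp i
    omega
  · have h0 := hX i hi
    have h0' := hX (i + 1) (by omega)
    have e1 := hs i hi
    have e2 := hB.step i
    have e3 := hB.step (i + r)
    have e4 := hs (i + r) (by omega)
    have e5 := hp i
    rw [show i + 1 + r = i + r + 1 by omega] at h0'
    have P1 := hB.pre_p_add i r
    have P2 := hP i hi
    have P3 := hP (i + r) (by omega)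
    have P5 := hB.pre_le_iff hf.bin (i + r - 1) (n + (X + (r - 1) * j + 1))
    have P4 : pre f (n + (X + (r - 1) * j + 1)) ≤ pre f (p (i + r - 1)) - 1 ↔
        n + (X + (r - 1) * j + 1) < p (i + r - 1) := by
      have a1 := hB.pre_le_iff hf.bin (i + r - 1 - 1) (n + (X + (r - 1) * j + 1)) (t := j - 1)
        (by omega)
      have a2 := hB.pre_p_succ (i + r - 1 - 1)
      have a3 := hB.step (i + r - 1 - 1)
      rcases Nat.lt_or_ge (i + r) 2 with h | h
      · omega
      · rw [show i + r - 1 - 1 + 1 = i + r - 1 by omega] at a2 a3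
        rw [a1 (by omega)]; omega
    have P6 := hB.pre_ones (i - 1) (t := j - 1) (by omega)
    have P7 := hB.pre_zeros i
    have P8 := hB.pre_ones i
    rw [win_eq_iff]
    have y0 := hB.y_pos (i + r - 1)
    have y1 := hB.y_pos i
    have hR : ((r * j : ℕ) : ℤ) = r * j := by push_cast; ring
    generalize (r - 1) * j = R at *
    generalize r * j = R' at *
    rw [← hR] at P1
    clear hX hs hP hp
    have hle : n ≤ p i - 1 + 1 ↔ n ≤ p i := by clear P4 P5 P6 P7 P8; omega
    replace h1 : p i ≤ n + 1 := by clear P4 P5 P6 P7 P8; omega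
    replace h2 : n + 1 < p i + y i + j := by clear P4 P5 P6 P7 P8; omega
    rw [hle]
    clear hle
    rcases lt_or_ge n (p i) with h3 | h3
    · rw [show p (i - 1) + y (i - 1) + (j - 1) = n by omega] at P6
      push_cast [show 1 ≤ j by omega] at P6
      rw [P5 (t := 0) (by omega) (by omega)]
      rw [show pre f n + (R + 1) - 1 = pre f (p (i + r - 1)) - 1 by omega, P4]
      omega
    · clear P6 P4
      rcases le_or_gt n (p i + y i) with h4 | h4
      · obtain ⟨t, rfl⟩ := Nat.exists_eq_add_of_le h3
        have P7 := P7 (t := t) (by omega)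
        rw [P5 (t := 1) (by omega) (by push_cast; omega), P5 (t := 0) (by omega) (by omega)]
        clear P1 P2 P3 P5 P7 P8
        omega
      · obtain ⟨t, rfl⟩ := Nat.exists_eq_add_of_le h4.le
        have P8 := P8 (t := t) (by omega)
        rw [P5 (t := t + 1) (by omega) (by push_cast; omega),
          P5 (t := t) (by omega) (by omega)]
        clear P1 P2 P3 P5 P7 P8
        omega
  · have h1 := hB.step i
    have h2 := hB.y_pos i
    have h3 : p (i + 1) ≤ p (i + g) := by
      rcases hg.eq_or_lt with rfl | h4
      · rfl
      · exact (hB.p_strict (by omega)).le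
    omega

lemma Good.twoGaps_min_one (hf : Good f) (hB : Blocks f 1 p y) {r X : ℕ}
    (hX : ∀ i, 1 ≤ i → p i + X + r ≤ p (i + r)) (hX' : ∀ i, 1 ≤ i → p (i + r) ≠ p i + X + r + 1) :
    TwoGaps p fun i => p (i + r) = p i + X + r := by
  have hs : ∀ i, 1 ≤ i → p i = p (i - 1) + y (i - 1) + 1 := fun i hi => by
    rw [← hB.step, Nat.sub_add_cancel hi]
  have hP : ∀ i, 1 ≤ i → pre f (p i) = pre f (p (i - 1)) + 1 := fun i hi => by
    have := hB.pre_p_succ (i - 1)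
    rwa [Nat.sub_add_cancel hi] at this
  refine hf.twoGaps (j := 1) (by omega) (A := fun i => p i - 2) (b := 1) (N := X + r + 2) (x := 2)
    (z := 0) (e := 0) (c := r + 1) (C := 0) (fun i hi => ?_) (fun i hi => ?_)
    (fun i hi t ht => ?_) (by omega) (fun i hi => ?_) (fun i n hi h1 h2 => ?_)
    (fun i g hi hg h => ?_)
  · have := hs i hi; have := hB.y_pos (i - 1); omega
  · have h1 := hs i hi
    have := hB.y_pos (i - 1)
    have h2 := hB.pre_zeros (i - 1) (t := y (i - 1) - 1) (by omega)
    have h3 := hB.pre_p i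
    have h4 := hP i hi
    rw [show p i - 2 = p (i - 1) + (y (i - 1) - 1) by omega, h2]
    push_cast at *
    linarith
  · have h1 := hs i hi
    have := hB.y_pos (i - 1)
    have := hB.zero (i - 1) (y (i - 1) - 1) (by omega)
    rwa [show p i - 2 + t = p (i - 1) + (y (i - 1) - 1) by omega]
  · have := hs i hi
    have := hB.y_pos (i - 1)
    have := hB.step i
    have := hB.y_pos i
    omega
  · have h0 := hX i hi
    have h0' := hX (i + 1) (by omega)
    have h0'' := hX' i hi
    have e1 := hs i hi
    have e2 := hB.step i
    have e3 := hB.step (i + r)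
    have e4 := hs (i + r) (by omega)
    rw [show i + 1 + r = i + r + 1 by omega] at h0'
    have P1 := hB.pre_p_add i r
    have P2 := hP i hi
    have P3 := hP (i + r) (by omega)
    have P4 := hB.pre_le_iff hf.bin (i + r) (n + (X + r + 2)) (t := 0) (by omega)
    have P5 := hB.pre_le_iff hf.bin (i + r - 1) (n + (X + r + 2)) (t := 0) (by omega)
    have P6 := hB.pre_zeros (i - 1)
    have P7 := hB.pre_zeros i
    rw [win_eq_iff]
    have y0 := hB.y_pos (i + r)
    have y1 := hB.y_pos (i - 1)
    have y2 := hB.y_pos i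
    rcases lt_or_ge n (p i) with h3 | h3
    · have P6 := P6 (t := n - p (i - 1)) (by omega)
      rw [show p (i - 1) + (n - p (i - 1)) = n by omega] at P6
      rw [P4 (by push_cast at *; omega), P5 (by push_cast at *; omega)]
      omega
    · have P7 := P7 (t := n - p i) (by omega)
      rw [show p i + (n - p i) = n by omega] at P7
      have := (P4 (v := pre f n + (r + 1) - 1) (by push_cast at *; omega)).2
      omega
  · push_cast; omega

lemma Good.twoGaps_max_one (hf : Good f) (hB : Blocks f 1 p y) {r X : ℕ} (hr : 1 ≤ r)
    (hXr : 2 ≤ X + r)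
    (hX : ∀ i, 1 ≤ i → p (i + r) ≤ p i + X + r) (hX' : ∀ i, 1 ≤ i → p (i + r) + 1 ≠ p i + X + r) :
    TwoGaps p fun i => p (i + r) = p i + X + r := by
  have hs : ∀ i, 1 ≤ i → p i = p (i - 1) + y (i - 1) + 1 := fun i hi => by
    rw [← hB.step, Nat.sub_add_cancel hi]
  have hP : ∀ i, 1 ≤ i → pre f (p i) = pre f (p (i - 1)) + 1 := fun i hi => by
    have := hB.pre_p_succ (i - 1)
    rwa [Nat.sub_add_cancel hi] at this
  refine hf.twoGaps (j := 1) (by omega) (A := fun i => p i) (b := 1) (N := X + r - 2) (x := 0)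
    (z := 0) (e := 0) (c := r - 1) (C := 1) (fun i hi => rfl) (fun i hi => ?_)
    (fun i hi t ht => ?_) (by omega) (fun i hi => ?_) (fun i n hi h1 h2 => ?_)
    (fun i g hi hg h => ?_)
  · have h3 := hB.pre_p i
    push_cast at *
    linarith
  · have := hB.y_pos i
    exact hB.zero i t (by omega)
  · have := hB.step i
    have := hB.y_pos i
    omega
  · have h0 := hX i hi
    have h0'' := hX' i hi
    have e2 := hB.step i
    have e4 := hs (i + r) (by omega)
    have P1 := hB.pre_p_add i r
    have P3 := hP (i + r) (by omega)
    have P5 := hB.pre_le_iff hf.bin (i + r - 1) (n + (X + r - 2)) (t := 0) (by omega)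
    have P4 : pre f (n + (X + r - 2)) ≤ pre f (p (i + r - 1)) - 1 ↔
        n + (X + r - 2) < p (i + r - 1) := by
      have a1 := hB.pre_le_iff hf.bin (i + r - 1 - 1) (n + (X + r - 2)) (t := 0)
        (by omega)
      have a2 := hB.pre_p_succ (i + r - 1 - 1)
      have a3 := hB.step (i + r - 1 - 1)
      rcases Nat.lt_or_ge (i + r) 2 with h | h
      · omega
      · rw [show i + r - 1 - 1 + 1 = i + r - 1 by omega] at a2 a3
        rw [a1 (by push_cast at *; omega)]; omega
    have P7 := hB.pre_zeros i (t := n - p i) (by omega)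
    rw [win_eq_iff]
    have y1 := hB.y_pos (i + r - 1)
    have y2 := hB.y_pos i
    rw [show p i + (n - p i) = n by omega] at P7
    rw [P5 (by push_cast at *; omega), show pre f n + (r - 1) - 1 = pre f (p (i + r - 1)) - 1 by
      push_cast at *; omega, P4]
    omega
  · push_cast; omega

lemma Blocks.ultPer (hB : Blocks f j p y) (h : ∃ L T, 0 < T ∧ ∀ n, L ≤ n → y (n + T) = y n) :
    UltPer f := by
  obtain ⟨L, T, hT, h⟩ := h
  obtain ⟨q, hq⟩ := Nat.exists_eq_add_of_le (hB.p_strict (show L < L + T by omega)).le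
  have hp : ∀ k, p (L + k + T) = p (L + k) + q := by
    intro k
    induction k with
    | zero => simpa using hq
    | succ k ih =>
      rw [show L + (k + 1) + T = L + k + T + 1 by omega, hB.step, ih, h _ (by omega),
        ← add_assoc, hB.step]
      omega
  have hq0 : 0 < q := by have := hB.p_strict (show L < L + T by omega); omega
  refine ⟨p L, q, hq0, fun n hn => ?_⟩
  have hfind : ∀ k, n < p (L + k) → ∃ i t, n = p (L + i) + t ∧ t < y (L + i) + j := by
    intro k
    induction k with
    | zero => intro h; simp only [add_zero] at h; omega
    | succ k ih =>
      intro h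
      by_cases h1 : n < p (L + k)
      · exact ih h1
      · exact ⟨k, n - p (L + k), by omega, by rw [← add_assoc, hB.step] at h; omega⟩
  have hge : ∀ k, k ≤ p (L + k) := by
    intro k
    induction k with
    | zero => omega
    | succ k ih => have := hB.p_strict (show L + k < L + (k + 1) by omega); omega
  obtain ⟨i, t, rfl, ht⟩ := hfind (n + 1) (by have := hge (n + 1); omega)
  rw [show p (L + i) + t + q = p (L + i + T) + t by rw [hp]; omega]
  have hy := h (L + i) (by omega)
  rcases lt_or_ge t (y (L + i)) with h1 | h1
  · rw [hB.zero _ _ h1, hB.zero _ _ (by omega)]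
  · have h2 := hB.one (L + i) (t - y (L + i)) (by omega)
    have h3 := hB.one (L + i + T) (t - y (L + i)) (by omega)
    rw [hy] at h3
    rw [show p (L + i) + t = p (L + i) + y (L + i) + (t - y (L + i)) by omega, h2,
      show p (L + i + T) + t = p (L + i + T) + y (L + i) + (t - y (L + i)) by omega, h3]

lemma frequently_of_not_ultPer {y : ℕ → ℕ} {x z : ℕ} (hy : ∀ i, y i = x ∨ y i = z)
    (hper : ¬ ∃ L T, 0 < T ∧ ∀ n, L ≤ n → y (n + T) = y n) (M : ℕ) : ∃ i, M ≤ i ∧ y i = x := by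
  by_contra! h
  exact hper ⟨M, 1, one_pos, fun n hn => by
    rw [(hy n).resolve_left (h n hn), (hy (n + 1)).resolve_left (h _ (by omega))]⟩

lemma exists_long_gap_ne {x z : ℕ} (hxz : x ≠ z) (hy : ∀ i, y i = x ∨ y i = z)
    (hper : ¬ ∃ L T, 0 < T ∧ ∀ n, L ≤ n → y (n + T) = y n) {s : ℕ}
    (hz : ∀ i d, 1 ≤ i → y i = z → 2 ≤ d → Gap y i d → d = s) :
    ∃ i d i' d', 1 ≤ i ∧ 1 ≤ i' ∧ y i = x ∧ y i' = x ∧ 2 ≤ d ∧ 2 ≤ d' ∧ d ≠ d' ∧ Gap y i d ∧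
      Gap y i' d' := by
  have hfx := frequently_of_not_ultPer hy hper
  have hfz := frequently_of_not_ultPer (fun i => (hy i).symm) hper
  by_cases h0 : ∃ i d, 1 ≤ i ∧ y i = x ∧ 2 ≤ d ∧ Gap y i d
  · obtain ⟨i, d, h1, h2, h3, h4⟩ := h0
    by_contra! h
    exact hper (ultPer_of_gaps hxz hy hfx hfz (r := d)
      (fun i' d' h1' h2' h3' h4' => by
        by_contra hne
        exact h i d i' d' h1 h1' h2 h2' h3 h3' (Ne.symm hne) h4 h4') hz)
  · push Not at h0
    exact absurd (ultPer_of_gaps hxz hy hfx hfz (r := 0)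
      (fun i d h1 h2 h3 h4 => absurd h4 (h0 i d h1 h2 h3)) hz) hper

lemma pGap_of_gap {x i d : ℕ} (hi : 1 ≤ i) (hx : y i = x) (h : Gap y i d) :
    PGap (fun i => y i = x) i d :=
  ⟨hi, h.1, hx, h.2.1.trans hx, fun k h1 h2 => hx ▸ h.2.2 k h1 h2⟩

/-- If one value is never repeated, the gaps between changes of value are too many. -/
lemma _root_.BinWord.TwoGaps.congr {I J : ℕ → Prop} (h : ∀ i, I i ↔ J i) (hG : TwoGaps p J) :
    TwoGaps p I := by
  rwa [show I = J from funext fun i => propext (h i)]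

lemma false_of_no_repeat {x z : ℕ} (hstep : ∀ i, p (i + 1) = p i + y i + j) (hxz : x ≠ z)
    (hy : ∀ i, y i = x ∨ y i = z)
    (hper : ¬ ∃ L T, 0 < T ∧ ∀ n, L ≤ n → y (n + T) = y n)
    (hno : ∀ i, 1 ≤ i → y i = x → y (i + 1) = z) (hG : TwoGaps p fun i => y i ≠ y (i + 1)) :
    False := by
  obtain ⟨i, d, i', d', h1, h1', h2, h2', h3, h3', hne, h4, h4'⟩ :=
    exists_long_gap_ne hxz hy hper (s := 2) fun i d hi hz hd hg => by
      have h1 := (hy (i + 1)).resolve_right (hz ▸ hg.2.2 (i + 1) (by omega) (by omega))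
      have h2 := hno (i + 1) (by omega) h1
      by_contra hd2
      exact hg.2.2 (i + 2) (by omega) (by omega) (h2.trans hz.symm)
  have key : ∀ i d, 1 ≤ i → y i = x → 2 ≤ d → Gap y i d →
      PGap (fun i => y i ≠ y (i + 1)) i (d - 1) ∧ y (i + (d - 1)) = z ∧
      PGap (fun i => y i ≠ y (i + 1)) (i + (d - 1)) 1 := by
    intro i d hi hx hd hg
    have hz : ∀ k, i < k → k < i + d → y k = z := fun k k1 k2 =>
      (hy k).resolve_left (hx ▸ hg.2.2 k k1 k2)
    have hx' : y (i + d) = x := hg.2.1.trans hx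
    have hz' := hno (i + d) (by omega) hx'
    have e0 := hz (i + (d - 1)) (by omega) (by omega)
    have e1 : y (i + (d - 1)) ≠ y (i + (d - 1) + 1) := by
      rw [e0, show i + (d - 1) + 1 = i + d by omega, hx']; exact hxz.symm
    refine ⟨⟨hi, by omega, ?_, e1, fun k k1 k2 => ?_⟩, e0, ⟨by omega, one_pos, e1, ?_, ?_⟩⟩
    · beta_reduce; rw [hx, hno i hi hx]; exact hxz
    · beta_reduce; rw [hz k k1 (by omega), hz (k + 1) (by omega) (by omega)]; simp
    · beta_reduce; rw [show i + (d - 1) + 1 = i + d by omega, hx', hz']; exact hxz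
    · intro k k1 k2; omega
  obtain ⟨a1, a2, a3⟩ := key i d h1 h2 h3 h4
  obtain ⟨b1, -, -⟩ := key i' d' h1' h2' h3' h4'
  have e1 := hstep i
  have e2 := hstep i'
  have e3 := hstep (i + (d - 1))
  have h := hG _ _ _ _ _ _ a1 b1 a3
  rcases h with ⟨h, -⟩ | ⟨h, h'⟩ | ⟨h, h'⟩
  · omega
  · simp only [h] at h' a2 e3; omega
  · simp only [h] at h'; omega

lemma false_of_twoGaps {x z : ℕ} (hstep : ∀ i, p (i + 1) = p i + y i + j) (hxz : x ≠ z)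
    (hy : ∀ i, y i = x ∨ y i = z)
    (hper : ¬ ∃ L T, 0 < T ∧ ∀ n, L ≤ n → y (n + T) = y n)
    (hGx : TwoGaps p fun i => y i = x) (hGz : TwoGaps p fun i => y i = z)
    (hx : (∀ i, 1 ≤ i → y i = x → y (i + 1) = z) → TwoGaps p fun i => y i ≠ y (i + 1))
    (hz : (∀ i, 1 ≤ i → y i = z → y (i + 1) = x) → TwoGaps p fun i => y i ≠ y (i + 1)) :
    False := by
  by_cases h1 : ∀ i, 1 ≤ i → y i = x → y (i + 1) = z
  · exact false_of_no_repeat hstep hxz hy hper h1 (hx h1)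
  by_cases h2 : ∀ i, 1 ≤ i → y i = z → y (i + 1) = x
  · exact false_of_no_repeat hstep hxz.symm (fun i => (hy i).symm) hper h2 (hz h2)
  push Not at h1 h2
  obtain ⟨a, ha, ha1, ha2⟩ := h1
  obtain ⟨b, hb, hb1, hb2⟩ := h2
  have pa : PGap (fun i => y i = x) a 1 :=
    ⟨ha, one_pos, ha1, (hy _).resolve_right ha2, fun k _ _ => by omega⟩
  have pb : PGap (fun i => y i = z) b 1 :=
    ⟨hb, one_pos, hb1, (hy _).resolve_left hb2, fun k _ _ => by omega⟩
  have huniq : ∀ v c, PGap (fun i => y i = v) c 1 → TwoGaps p (fun i => y i = v) →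
      ∀ i d i' d', 1 ≤ i → 1 ≤ i' → y i = v → y i' = v → 2 ≤ d → 2 ≤ d' → Gap y i d →
      Gap y i' d' → d = d' := by
    intro v c hc hG i d i' d' h1 h1' h2 h2' h3 h3' h4 h4'
    have := hG _ _ _ _ _ _ hc (pGap_of_gap h1 h2 h4) (pGap_of_gap h1' h2' h4')
    omega
  have hz : ∃ s, ∀ i d, 1 ≤ i → y i = z → 2 ≤ d → Gap y i d → d = s := by
    by_cases h0 : ∃ i d, 1 ≤ i ∧ y i = z ∧ 2 ≤ d ∧ Gap y i d
    · obtain ⟨i, d, h1, h2, h3, h4⟩ := h0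
      exact ⟨d, fun i' d' h1' h2' h3' h4' =>
        huniq z b pb hGz i' d' i d h1' h1 h2' h2 h3' h3 h4' h4⟩
    · push Not at h0
      exact ⟨0, fun i d h1 h2 h3 h4 => absurd h4 (h0 i d h1 h2 h3)⟩
  obtain ⟨s, hs⟩ := hz
  obtain ⟨i, d, i', d', h1, h1', h2, h2', h3, h3', hne, h4, h4'⟩ :=
    exists_long_gap_ne hxz hy hper hs
  exact hne (huniq x a pa hGx i d i' d' h1 h1' h2 h2' h3 h3' h4 h4')

end Blocks

lemma Good.oneRun_close (hf : Good f) {j m l : ℕ} (h : OneRun f j m l) : j = 1 ∧ l = m + 1 := by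
  by_contra hne
  have hlt := h.lt
  obtain ⟨s, p, y, hB, hy⟩ := hf.exists_blocks h
  have hg := hf.shift s
  generalize (fun n => f (n + s)) = g at hB hg
  have hj := hB.pos
  have hy1 := hB.y_pos
  have hm1 : 1 ≤ m := by
    obtain ⟨i, hi⟩ := h.left
    exact hi.1
  have e1 := hB.step
  have e2 : ∀ i, p (i + 2) = p i + y i + y (i + 1) + 2 * j := fun i => by
    rw [e1 (i + 1), e1 i]; ring
  clear h
  rcases hj.eq_or_lt with rfl | hj
  · refine false_of_twoGaps e1 hlt.ne hy (fun hper => hg.not_ultPer (hB.ultPer hper)) ?_ ?_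
      (fun hno => ?_) fun hno => ?_
    · refine .congr (fun i => ?_) (hg.twoGaps_min_one hB (r := 1) (X := m) ?_ ?_)
      · have := e1 i; have := hy i; omega
      · intro i _; have := e1 i; have := hy i; omega
      · intro i _; have := e1 i; have := hy i; omega
    · refine .congr (fun i => ?_) (hg.twoGaps_max_one hB (r := 1) (X := l) le_rfl ?_ ?_ ?_)
      · have := e1 i; have := hy i; omega
      · omega
      · intro i _; have := e1 i; have := hy i; omega
      · intro i _; have := e1 i; have := hy i; omega
    · refine .congr (fun i => ?_) (hg.twoGaps_min_one hB (r := 2) (X := m + l) ?_ ?_)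
      · have := e2 i; have := hy i; have := hy (i + 1); omega
      · intro i h; have := e2 i; have := hy i; have := hy (i + 1); have := hno i h; omega
      · intro i h; have := e2 i; have := hy i; have := hy (i + 1); have := hno i h; omega
    · refine .congr (fun i => ?_) (hg.twoGaps_max_one hB (r := 2) (X := m + l) ?_ ?_ ?_ ?_)
      · have := e2 i; have := hy i; have := hy (i + 1); omega
      · omega
      · omega
      · intro i h; have := e2 i; have := hy i; have := hy (i + 1); have := hno i h; omega
      · intro i h; have := e2 i; have := hy i; have := hy (i + 1); have := hno i h; omega
  · refine false_of_twoGaps e1 hlt.ne hy (fun hper => hg.not_ultPer (hB.ultPer hper)) ?_ ?_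
      (fun hno => ?_) fun hno => ?_
    · refine .congr (fun i => ?_) (hg.twoGaps_min hB hj (r := 1) (X := m) ?_)
      · have := e1 i; have := hy i; omega
      · intro i _; have := e1 i; have := hy i; omega
    · refine .congr (fun i => ?_) (hg.twoGaps_max hB hj (r := 1) (X := l) le_rfl ?_)
      · have := e1 i; have := hy i; omega
      · intro i _; have := e1 i; have := hy i; omega
    · refine .congr (fun i => ?_) (hg.twoGaps_min hB hj (r := 2) (X := m + l) ?_)
      · have := e2 i; have := hy i; have := hy (i + 1); omega
      · intro i h; have := e2 i; have := hy i; have := hy (i + 1); have := hno i h; omega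
    · refine .congr (fun i => ?_) (hg.twoGaps_max hB hj (r := 2) (X := m + l) ?_ ?_)
      · have := e2 i; have := hy i; have := hy (i + 1); omega
      · omega
      · intro i h; have := e2 i; have := hy i; have := hy (i + 1); have := hno i h; omega

/-- A word in which each factor of a fixed length has, far enough, a unique right extension is
ultimately periodic. -/
lemma ultPer_of_deterministic (hb : ∀ n, f n = 0 ∨ f n = 1) {N L : ℕ}
    (h : ∀ i j, L ≤ i → L ≤ j → (∀ t < N, f (i + t) = f (j + t)) → f (i + N) = f (j + N)) :
    UltPer f := by
  classical
  obtain ⟨i, j, hne, hij⟩ := Finite.exists_ne_map_eq_of_infinite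
    fun (i : ℕ) (t : Fin N) => decide (f (L + i + t) = 1)
  wlog hlt : i < j generalizing i j
  · exact this j i hne.symm hij.symm (by omega)
  have h0 : ∀ s, ∀ t < N, f (L + i + s + t) = f (L + j + s + t) := by
    intro s
    induction s with
    | zero =>
      intro t ht
      have h1 := congrFun hij ⟨t, ht⟩
      have h2 := hb (L + i + t)
      have h3 := hb (L + j + t)
      simp only [decide_eq_decide] at h1
      simp only [add_zero]
      omega
    | succ s ih =>
      intro t ht
      rcases Nat.lt_or_ge (t + 1) N with h1 | h1
      · have := ih (t + 1) h1
        rw [show L + i + (s + 1) + t = L + i + s + (t + 1) by omega, this]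
        congr 1; omega
      · have := h (L + i + s) (L + j + s) (by omega) (by omega) ih
        rw [show L + i + (s + 1) + t = L + i + s + N by omega, this]
        congr 1; omega
  refine ⟨L + i + N, j - i, by omega, fun n hn => ?_⟩
  have := h _ _ (by omega) (by omega) (h0 (n - (L + i + N)))
  rw [show n = L + i + (n - (L + i + N)) + N by omega, this]
  congr 1; omega

/-- The windows of length `K + 1` have two levels `c` and `c + 1`, and `0 x 0`, `1 x 1` are the
windows of length `K + 2` of extreme weights. -/
structure Imbalance (f : ℕ → ℤ) (K : ℕ) (c : ℤ) (x : ℕ → ℤ) : Prop where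
  levels : ∀ i, win f (K + 1) i = c ∨ win f (K + 1) i = c + 1
  low : ∀ i, win f (K + 1) i = c → f (i + (K + 1)) = 0 →
    f i = 0 ∧ ∀ t, 1 ≤ t → t ≤ K → f (i + t) = x t
  high : ∀ i, win f (K + 1) i = c + 1 → f (i + (K + 1)) = 1 →
    f i = 1 ∧ ∀ t, 1 ≤ t → t ≤ K → f (i + t) = x t
  exists_low : ∃ i, win f (K + 1) i = c ∧ f (i + (K + 1)) = 0
  exists_high : ∃ i, win f (K + 1) i = c + 1 ∧ f (i + (K + 1)) = 1
  inner : ∀ i j, win f (K + 1) i = c → f i = 1 → f (i + (K + 1)) = 1 →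
    win f (K + 1) j = c + 1 → f j = 0 → f (j + (K + 1)) ≠ 0

lemma Imbalance.flip {K : ℕ} {c : ℤ} {x : ℕ → ℤ} (h : Imbalance f K c x) :
    Imbalance (BinWord.flip f) K (K - c) (BinWord.flip x) where
  levels i := by have := h.levels i; rw [win_flip]; push_cast; omega
  low i h1 h2 := by
    rw [win_flip] at h1; push_cast at h1; simp only [BinWord.flip] at h2 ⊢
    obtain ⟨h3, h4⟩ := h.high i (by omega) (by omega)
    exact ⟨by omega, fun t a b => by rw [h4 t a b]⟩
  high i h1 h2 := by
    rw [win_flip] at h1; push_cast at h1; simp only [BinWord.flip] at h2 ⊢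
    obtain ⟨h3, h4⟩ := h.low i (by omega) (by omega)
    exact ⟨by omega, fun t a b => by rw [h4 t a b]⟩
  exists_low := by
    obtain ⟨i, h1, h2⟩ := h.exists_high
    exact ⟨i, by rw [win_flip]; push_cast; omega, by simp [BinWord.flip, h2]⟩
  exists_high := by
    obtain ⟨i, h1, h2⟩ := h.exists_low
    exact ⟨i, by rw [win_flip]; push_cast; omega, by simp [BinWord.flip, h2]⟩
  inner i j h1 h2 h3 h4 h5 h6 := by
    rw [win_flip] at h1 h4; push_cast at h1 h4; simp only [BinWord.flip] at h2 h3 h5 h6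
    exact h.inner j i (by omega) (by omega) (by omega) (by omega) (by omega) (by omega)

lemma exists_last {g : ℕ → ℤ} {c : ℤ} (hg : ∀ i, g i = c ∨ g i = c + 1) {P r : ℕ}
    (hP : g P = c + 1) (hr : P < r) (hc : g r = c) :
    ∃ i, g i = c + 1 ∧ i < r ∧ ∀ k, i < k → k ≤ r → g k = c := by
  induction r, hr using Nat.le_induction with
  | base => exact ⟨P, hP, by omega, fun k h1 h2 => by rwa [show k = P + 1 by omega]⟩
  | succ r hr ih =>
    rcases hg r with h | h
    · obtain ⟨i, h1, h2, h3⟩ := ih h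
      refine ⟨i, h1, by omega, fun k h4 h5 => ?_⟩
      rcases h5.eq_or_lt with rfl | h6
      · exact hc
      · exact h3 k h4 (by omega)
    · exact ⟨r, h, by omega, fun k h1 h2 => by rwa [show k = r + 1 by omega]⟩

lemma Good.exists_zRun_ge (hf : Good f) {n i : ℕ} (hn : 1 ≤ n) (h : ∀ t < n, f (i + t) = 0) :
    ∃ k j, ZRun f k j ∧ n ≤ k := by
  obtain ⟨P, -, hP⟩ := hf.exists_eq 0 (c := 1) (by omega)
  obtain ⟨r, hr, h1⟩ := hf.rec_ i n (P + 1)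
  have h2 : ∀ t < n, f (r + t) = 0 := fun t ht => (h1 t ht).trans (h t ht)
  obtain ⟨j, hj, hjr, h3⟩ := exists_last (c := 0) hf.bin hP (by omega) (h2 0 (by omega))
  rw [zero_add] at hj
  obtain ⟨k, hk⟩ := hf.exists_zRun_at hj (h3 _ (by omega) (by omega))
  refine ⟨k, j, hk, ?_⟩
  by_contra hlt
  have h4 := hk.2.2.2
  rcases Nat.lt_or_ge r (j + k + 1) with h5 | h5
  · have := h2 (j + k + 1 - r) (by omega)
    rw [show r + (j + k + 1 - r) = j + k + 1 by omega] at this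
    omega
  · have := h3 (j + k + 1) (by omega) h5
    omega

lemma Good.exists_oRun_ge (hf : Good f) {n i : ℕ} (hn : 1 ≤ n) (h : ∀ t < n, f (i + t) = 1) :
    ∃ k j, ORun f k j ∧ n ≤ k := by
  obtain ⟨k, j, h1, h2⟩ := hf.flip.exists_zRun_ge (i := i) hn fun t ht => by
    simp [BinWord.flip, h t ht]
  exact ⟨k, j, zRun_flip.1 h1, h2⟩

lemma Good.imbalance_zero (hf : Good f) {K : ℕ} {c : ℤ} {x : ℕ → ℤ} (h : Imbalance f K c x)
    (hb : ∀ i, win f (K + 1) i = c → f (i + (K + 1)) = 1 → f i = 0)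
    (ha : ∃ i, win f (K + 1) i = c + 1 ∧ f i = 0 ∧ f (i + (K + 1)) = 0) :
    ∀ t, 1 ≤ t → t ≤ K → x t = 0 := by
  by_contra hne
  have hx : (1 ≤ K → x 1 = 0) → (∀ t, 1 ≤ t → t + 1 ≤ K → x (t + 1) = x t) → False := by
    intro h1 h2
    refine hne fun t ht => ?_
    induction t, ht using Nat.le_induction with
    | base => exact h1
    | succ t ht ih => exact fun h3 => (h2 t ht h3).trans (ih (by omega))
  have hrep : ∀ i, win f (K + 1) i = c → f (i + (K + 1)) = 0 → win f (K + 1) (i + 1) = c →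
      f (i + 1 + (K + 1)) ≠ 0 := by
    intro i h1 h2 h3 h4
    obtain ⟨h5, h6⟩ := h.low i h1 h2
    obtain ⟨h7, h8⟩ := h.low _ h3 h4
    refine hx (fun h9 => (h6 1 le_rfl h9).symm.trans h7) fun t h9 h10 => ?_
    rw [← h6 _ (by omega) h10, ← h8 t h9 (by omega)]
    congr 1; omega
  have hstay : ∀ i, win f (K + 1) i = c → win f (K + 1) (i + 1) = c → f (i + (K + 1)) = 0 := by
    intro i h1 h2
    have h3 := win_succ (f := f) (K + 1) i
    have h4 := hf.bin (i + (K + 1))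
    by_contra h5
    have := hb i h1 (by omega)
    omega
  obtain ⟨P, hP, hP0, hP1⟩ := ha
  obtain ⟨Q, hQ, hQ1⟩ := h.exists_high
  have hQ0 := (h.high Q hQ hQ1).1
  have hle : ∀ i d, win f (K + 1) i = c + 1 → IsRet f (K + 1) i d → d ≤ 3 := by
    intro i d hi hd
    by_contra hd4
    have hk : ∀ k, i < k → k < i + d → win f (K + 1) k = c := fun k h1 h2 =>
      (h.levels k).resolve_right (hi ▸ hd.2.2 k h1 h2)
    have h1 := hk (i + 1) (by omega) (by omega)
    have h2 := hk (i + 1 + 1) (by omega) (by omega)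
    have h3 := hk (i + 1 + 1 + 1) (by omega) (by omega)
    exact hrep (i + 1) h1 (hstay _ h1 h2) h2 (hstay _ h2 h3)
  have hlast : ∀ r, P < r → win f (K + 1) r = c → ∃ i d, win f (K + 1) i = c + 1 ∧
      IsRet f (K + 1) i d ∧ i < r ∧ r < i + d ∧ (∀ k, i < k → k < i + d → win f (K + 1) k = c) := by
    intro r hr hc
    obtain ⟨i, h1, h2, h3⟩ := exists_last h.levels hP hr hc
    obtain ⟨d, hd⟩ := hf.exists_isRet (K + 1) i
    refine ⟨i, d, h1, hd, h2, ?_, fun k h4 h5 =>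
      (h.levels k).resolve_right (h1 ▸ hd.2.2 k h4 h5)⟩
    by_contra h4
    have h5 := h3 (i + d) (by have := hd.1; omega) (by omega)
    have h6 := hd.2.1
    omega
  have h3 : ∃ i, win f (K + 1) i = c + 1 ∧ IsRet f (K + 1) i 3 := by
    obtain ⟨r, h1, h2⟩ := h.exists_low
    obtain ⟨r', h3, h4⟩ := hf.rec_ r (K + 1 + 1) (P + 1)
    have h5 : win f (K + 1) r' = c := (pre_add_congr h4 (K + 1) (by omega)).trans h1
    have h6 := (h4 (K + 1) (by omega)).trans h2
    have h7 : win f (K + 1) (r' + 1) = c := by rw [win_succ, (h.low _ h5 h6).1, h6, h5]; ring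
    obtain ⟨i, d, h8, h9, h10, h11, h12⟩ := hlast (r' + 1) (by omega) h7
    obtain rfl : d = 3 := by
      have := hle i d h8 h9
      rcases Nat.lt_or_ge i r' with h13 | h13
      · omega
      · obtain ⟨i', d', h8', h9', h10', h11', h12'⟩ := hlast r' (by omega) h5
        have : i = r' := by omega
        subst this; omega
    exact ⟨i, h8, h9⟩
  obtain ⟨i₃, hi₃, hr₃⟩ := h3
  have hcases : ∀ r, P < r → win f (K + 1) r = c →
      (win f (K + 1) (r - 1) = c + 1 ∧ f (r + (K + 1)) = 0) ∨
      (win f (K + 1) (r - 1) = c ∧ f (r - 1 + (K + 1)) = 0) := by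
    intro r hr hc
    obtain ⟨i, d, h1, h2, h3, h4, h5⟩ := hlast r hr hc
    have h6 : d = 3 := hf.ret_unique ⟨hP0, hP1, hP⟩ ⟨hQ0, hQ1, hQ⟩ h2 h1 (by omega) hr₃ hi₃
      (by omega)
    have h7 := hstay (i + 1) (h5 _ (by omega) (by omega)) (h5 _ (by omega) (by omega))
    rcases (show r = i + 1 ∨ r = i + 1 + 1 by omega) with rfl | rfl
    · exact .inl ⟨h1, h7⟩
    · exact .inr ⟨h5 _ (by omega) (by omega), h7⟩
  refine hf.not_ultPer (ultPer_of_deterministic hf.bin (N := K + 1) (L := P + 1)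
    fun i j hi hj hij => ?_)
  by_contra hne'
  wlog h01 : f (i + (K + 1)) = 0 ∧ f (j + (K + 1)) = 1 generalizing i j
  · have h1 := hf.bin (i + (K + 1))
    have h2 := hf.bin (j + (K + 1))
    exact this j i hj hi (fun t ht => (hij t ht).symm) (fun h => hne' h.symm) (by omega)
  obtain ⟨h0, h1⟩ := h01
  have hw : win f (K + 1) i = win f (K + 1) j := pre_add_congr hij (K + 1) le_rfl
  rcases h.levels i with h2 | h2
  · obtain ⟨h3, h4⟩ := h.low i h2 h0
    rcases hcases j (by omega) (hw.symm.trans h2) with ⟨h5, h6⟩ | ⟨h5, h6⟩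
    · omega
    · obtain ⟨h7, h8⟩ := h.low _ h5 h6
      refine hx (fun h9 => ?_) fun t h9 h10 => ?_
      · rw [← h8 1 le_rfl h9, show j - 1 + 1 = j by omega, ← h3]
        exact (hij 0 (by omega)).symm
      · rw [← h4 t h9 (by omega), hij t (by omega), ← h8 _ (by omega) h10]
        congr 1; omega
  · obtain ⟨h3, h4⟩ := h.high j (hw.symm.trans h2) h1
    have h5 : f i = 1 := (hij 0 (by omega)).trans h3
    have h6 : win f (K + 1) (i + 1) = c := by rw [win_succ]; omega
    rcases hcases (i + 1) (by omega) h6 with ⟨h7, h8⟩ | ⟨h7, h8⟩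
    · obtain ⟨h9, h10⟩ := h.low _ h6 h8
      refine hx (fun h11 => ?_) fun t h11 h12 => ?_
      · rw [← h4 1 le_rfl h11, ← hij 1 (by omega), h9]
      · rw [← h10 t h11 (by omega), ← h4 _ (by omega) h12, ← hij _ (by omega)]
        congr 1; omega
    · rw [Nat.add_sub_cancel] at h7; omega

lemma Good.imbalance_const (hf : Good f) {K : ℕ} {c : ℤ} {x : ℕ → ℤ} (h : Imbalance f K c x) :
    (∀ t, 1 ≤ t → t ≤ K → x t = 0) ∨ ∀ t, 1 ≤ t → t ≤ K → x t = 1 := by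
  by_cases ha : ∃ i, win f (K + 1) i = c + 1 ∧ f i = 0 ∧ f (i + (K + 1)) = 0
  · left
    refine hf.imbalance_zero h (fun i h1 h2 => (hf.bin i).resolve_right fun h3 => ?_) ha
    obtain ⟨j, h4, h5, h6⟩ := ha
    exact h.inner i j h1 h3 h2 h4 h5 h6
  by_cases hb : ∃ i, win f (K + 1) i = c ∧ f i = 1 ∧ f (i + (K + 1)) = 1
  · right
    have key := hf.flip.imbalance_zero h.flip (fun i h1 h2 => ?_) ?_
    · exact fun t h1 h2 => by have := key t h1 h2; simp only [BinWord.flip] at this; omega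
    · rw [win_flip] at h1; push_cast at h1; simp only [BinWord.flip] at h2 ⊢
      have := hf.bin i
      by_contra h3
      exact ha ⟨i, by omega, by omega, by omega⟩
    · obtain ⟨i, h1, h2, h3⟩ := hb
      exact ⟨i, by rw [win_flip]; push_cast; omega, by simp [BinWord.flip, h2],
        by simp [BinWord.flip, h3]⟩
  push Not at ha hb
  by_contra! hne
  obtain ⟨⟨t, h1, h2, h3⟩, s, h4, h5, h6⟩ := hne
  have shift : ∀ i e, f (i + 1) = e → (∀ t, 1 ≤ t → t ≤ K → f (i + t) = x t) →
      (∀ t, 1 ≤ t → t ≤ K → f (i + 1 + t) = x t) → ∀ t, 1 ≤ t → t ≤ K → x t = e := by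
    intro i e he h7 h8 t ht
    induction t, ht using Nat.le_induction with
    | base => exact fun h => (h7 1 le_rfl h).symm.trans he
    | succ t ht ih =>
      intro h
      rw [← h7 _ (by omega) h, ← ih (by omega), ← h8 t ht (by omega)]
      congr 1; omega
  have hx0 : x 1 = 0 := by
    obtain ⟨i, h7, h8⟩ := h.exists_low
    obtain ⟨h9, h10⟩ := h.low i h7 h8
    have h11 : win f (K + 1) (i + 1) = c := by rw [win_succ, h7, h8, h9]; ring
    rw [← h10 1 le_rfl (by omega)]
    rcases hf.bin (i + 1 + (K + 1)) with h12 | h12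
    · exact (h.low _ h11 h12).1
    · exact (hf.bin _).resolve_right fun h13 => hb _ h11 h13 h12
  have hx1 : x 1 = 1 := by
    obtain ⟨i, h7, h8⟩ := h.exists_high
    obtain ⟨h9, h10⟩ := h.high i h7 h8
    have h11 : win f (K + 1) (i + 1) = c + 1 := by rw [win_succ, h7, h8, h9]; ring
    rw [← h10 1 le_rfl (by omega)]
    rcases hf.bin (i + 1 + (K + 1)) with h12 | h12
    · exact (hf.bin _).resolve_left fun h13 => ha _ h11 h13 h12
    · exact (h.high _ h11 h12).1
  omega

/-- Windows of equal length differ in weight by at most one. -/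
def Balanced (f : ℕ → ℤ) : Prop := ∀ n i j, win f n j ≤ win f n i + 1

lemma Good.exists_imbalance (hf : Good f) (h : ¬ Balanced f) : ∃ K c x, Imbalance f K c x := by
  classical
  have h : ∃ n i j, win f n i + 1 < win f n j := by simpa [Balanced] using h
  let n := Nat.find h
  have hn : n = Nat.find h := rfl
  obtain ⟨p, q, hpq⟩ := Nat.find_spec h
  have hmin : ∀ k < n, ∀ i j, win f k j ≤ win f k i + 1 := by
    intro k hk i j
    have := Nat.find_min h hk
    push Not at this
    exact this i j
  rw [← hn] at hpq
  clear_value n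
  have hsplit : ∀ k l i, win f (k + l) i = win f k i + win f l (i + k) := by
    intro k l i
    simp only [win, add_assoc]; ring
  have hn2 : 2 ≤ n := by
    by_contra hlt
    rcases (show n = 0 ∨ n = 1 by omega) with rfl | rfl
    · simp [win] at hpq
    · rw [win_one, win_one] at hpq
      have := hf.bin p; have := hf.bin q; omega
  obtain ⟨K, rfl⟩ : ∃ K, n = K + 2 := ⟨n - 2, by omega⟩
  clear hn hn2
  have inner : ∀ i j, win f (K + 2) i + 1 < win f (K + 2) j →
      ∀ t, 1 ≤ t → t ≤ K + 1 → win f t j = win f t i + 1 := by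
    intro i j hij t h1 h2
    have h3 := hsplit t (K + 2 - t) i
    have h4 := hsplit t (K + 2 - t) j
    rw [show t + (K + 2 - t) = K + 2 by omega] at h3 h4
    have h5 := hmin t (by omega) i j
    have h6 := hmin (K + 2 - t) (by omega) (i + t) (j + t)
    omega
  have ends : ∀ i j, win f (K + 2) i + 1 < win f (K + 2) j →
      (f i = 0 ∧ f j = 1) ∧ (f (i + (K + 1)) = 0 ∧ f (j + (K + 1)) = 1) ∧
      ∀ t, 1 ≤ t → t ≤ K → f (j + t) = f (i + t) := by
    intro i j hij
    have h1 := inner i j hij 1 le_rfl (by omega)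
    have h2 := inner i j hij (K + 1) (by omega) le_rfl
    have h3 := hsplit (K + 1) 1 i
    have h4 := hsplit (K + 1) 1 j
    rw [show K + 1 + 1 = K + 2 by omega] at h3 h4
    rw [win_one] at h3 h4
    rw [win_one, win_one] at h1
    have := hf.bin i; have := hf.bin j
    have := hf.bin (i + (K + 1)); have := hf.bin (j + (K + 1))
    refine ⟨by omega, by omega, fun t h5 h6 => ?_⟩
    have h7 := inner i j hij t h5 (by omega)
    have h8 := inner i j hij (t + 1) (by omega) (by omega)
    rw [hsplit, hsplit, win_one, win_one] at h8
    omega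
  have hadd : ∀ i, win f (K + 2) i = win f (K + 1) i + f (i + (K + 1)) := by
    intro i
    rw [← win_one (f := f), ← hsplit]
  obtain ⟨⟨e1, e2⟩, ⟨e3, e4⟩, e5⟩ := ends p q hpq
  have h1 := inner p q hpq (K + 1) (by omega) le_rfl
  refine ⟨K, win f (K + 1) p, fun t => f (p + t), fun i => ?_, fun i h2 h3 => ?_, fun i h2 h3 => ?_,
    ⟨p, rfl, e3⟩, ⟨q, h1, e4⟩, fun i j h2 h3 h4 h5 h6 h7 => ?_⟩
  · have := hmin (K + 1) (by omega) i q
    have := hmin (K + 1) (by omega) p i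
    omega
  · have h4 := hadd i
    have h5 := hadd p
    obtain ⟨⟨g1, g2⟩, ⟨g3, g4⟩, g5⟩ := ends i q (by omega)
    exact ⟨g1, fun t h6 h7 => by rw [← g5 t h6 h7, e5 t h6 h7]⟩
  · have h4 := hadd i
    have h5 := hadd q
    have h6 := hadd p
    obtain ⟨⟨g1, g2⟩, ⟨g3, g4⟩, g5⟩ := ends p i (by omega)
    exact ⟨g2, g5⟩
  · have h8 := hsplit 1 K i
    have h9 := hsplit 1 K j
    rw [add_comm 1 K, win_one] at h8 h9
    have h10 := hadd i
    have h11 := hadd j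
    have h12 := win_succ (f := f) (K + 1) i
    have h13 := win_succ (f := f) (K + 1) j
    have h14 := hmin K (by omega) (i + 1) (j + 1)
    omega

/-- Words whose blocks of ones are single letters and whose blocks of zeros have two consecutive
lengths are balanced. -/
lemma Good.balanced_of_oneRun (hf : Good f) {j m l : ℕ} (h : OneRun f j m l) : Balanced f := by
  by_contra hnb
  obtain ⟨rfl, rfl⟩ := hf.oneRun_close h
  obtain ⟨K, c, x, hI⟩ := hf.exists_imbalance hnb
  obtain ⟨p, hp1, hp2⟩ := hI.exists_low
  obtain ⟨q, hq1, hq2⟩ := hI.exists_high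
  obtain ⟨hq3, hq4⟩ := hI.high q hq1 hq2
  have h11 : ∀ i, f i = 1 → f (i + 1) ≠ 1 := by
    intro i h1 h2
    obtain ⟨k, i', h3, h4⟩ := hf.exists_oRun_ge (n := 2) (i := i) (by omega) fun t ht => by
      interval_cases t
      · exact h1
      · exact h2
    have := h.ones _ _ h3
    omega
  obtain ⟨hp3, hp4⟩ := hI.low p hp1 hp2
  have hK : 1 ≤ K := by
    by_contra hK
    obtain rfl : K = 0 := by omega
    exact h11 q hq3 hq2
  rcases hf.imbalance_const hI with h0 | h1
  · obtain ⟨k, i', h3, h4⟩ := hf.exists_zRun_ge (n := K + 2) (i := p) (by omega) fun t ht => by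
      rcases Nat.eq_zero_or_pos t with rfl | h5
      · exact hp3
      · rcases (show t ≤ K ∨ t = K + 1 by omega) with h6 | rfl
        · rw [hp4 t h5 h6, h0 t h5 h6]
        · exact hp2
    have h5 : ZRun f K q := ⟨hK, hq3, fun t h6 h7 => by
      have h8 := hq4 (t - q) (by omega) (by omega)
      rw [h0 _ (by omega) (by omega), show q + (t - q) = t by omega] at h8
      exact h8, hq2⟩
    have h6 := h.zeros _ _ h5
    have h7 := h.zeros _ _ h3
    omega
  · exact h11 q hq3 ((hq4 1 le_rfl hK).trans (h1 1 le_rfl hK))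

/-- Position in `f` of the `t`-th symbol when the ones of `f` are read in pairs. -/
def pos (f : ℕ → ℤ) : ℕ → ℕ
  | 0 => 0
  | t + 1 => pos f t + 1 + (f (pos f t)).toNat

/-- The word obtained from `f` by replacing pairs of ones by single ones. -/
def half (f : ℕ → ℤ) (t : ℕ) : ℤ := f (pos f t)

/-- Words in which ones come in pairs, starting from the beginning of the word. -/
structure Paired (f : ℕ → ℤ) : Prop where
  bin : ∀ n, f n = 0 ∨ f n = 1
  odd : ∀ n, Odd (pre f n) → f n = 1

namespace Paired

variable (h : Paired f)
include h

lemma half_bin (t : ℕ) : half f t = 0 ∨ half f t = 1 := h.bin _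

lemma pos_succ (t : ℕ) : (pos f (t + 1) : ℤ) = pos f t + 1 + half f t := by
  have := h.half_bin t
  have h1 : pos f (t + 1) = pos f t + 1 + (half f t).toNat := rfl
  omega

lemma pos_succ_zero {t : ℕ} (ht : half f t = 0) : pos f (t + 1) = pos f t + 1 := by
  have := h.pos_succ t; omega

lemma pos_succ_one {t : ℕ} (ht : half f t = 1) : pos f (t + 1) = pos f t + 2 := by
  have := h.pos_succ t; omega

lemma pos_eq_pre (t : ℕ) :
    (pos f t : ℤ) = t + pre (half f) t ∧ pre f (pos f t) = 2 * pre (half f) t := by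
  induction t with
  | zero => simp [pos, pre_zero]
  | succ t ih =>
    obtain ⟨h1, h2⟩ := ih
    rw [h.pos_succ, pre_succ]
    refine ⟨by push_cast; omega, ?_⟩
    rcases h.half_bin t with h3 | h3
    · rw [h.pos_succ_zero h3, pre_succ]
      have : f (pos f t) = 0 := h3
      omega
    · have h4 : f (pos f t) = 1 := h3
      have h5 : pre f (pos f t + 1) = 2 * pre (half f) t + 1 := by rw [pre_succ]; omega
      have := h.odd (pos f t + 1) ⟨_, h5⟩
      rw [h.pos_succ_one h3, pre_succ]
      omega

lemma apply_pos_add_one {t : ℕ} (ht : half f t = 1) :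
    f (pos f t + 1) = 1 ∧ pre f (pos f t + 1) = 2 * pre (half f) t + 1 := by
  have h1 : f (pos f t) = 1 := ht
  have h5 : pre f (pos f t + 1) = 2 * pre (half f) t + 1 := by
    rw [pre_succ]; have := (h.pos_eq_pre t).2; omega
  exact ⟨h.odd _ ⟨_, h5⟩, h5⟩

lemma pos_strictMono : StrictMono (pos f) :=
  strictMono_nat_of_lt_succ fun t => by
    have := h.pos_succ t; have := h.half_bin t; omega

lemma cover (n : ℕ) : (∃ t, n = pos f t) ∨ ∃ t, half f t = 1 ∧ n = pos f t + 1 := by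
  induction n with
  | zero => exact .inl ⟨0, rfl⟩
  | succ n ih =>
    rcases ih with ⟨t, rfl⟩ | ⟨t, h1, rfl⟩
    · rcases h.half_bin t with h2 | h2
      · exact .inl ⟨t + 1, (h.pos_succ_zero h2).symm⟩
      · exact .inr ⟨t, h2, rfl⟩
    · exact .inl ⟨t + 1, (h.pos_succ_one h1).symm⟩

lemma exists_pos {n : ℕ} (hn : Even (pre f n)) : ∃ t, n = pos f t := by
  refine (h.cover n).resolve_right ?_
  rintro ⟨t, h1, rfl⟩
  rw [(h.apply_pos_add_one h1).2] at hn
  exact (Int.not_even_iff_odd.2 ⟨_, rfl⟩) hn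

lemma exists_pos_add_one {n : ℕ} (hn : Odd (pre f n)) : ∃ t, half f t = 1 ∧ n = pos f t + 1 := by
  refine (h.cover n).resolve_left ?_
  rintro ⟨t, rfl⟩
  rw [(h.pos_eq_pre t).2] at hn
  exact (Int.not_odd_iff_even.2 (even_two_mul _)) hn

lemma exists_pos_of_zero {n : ℕ} (hn : f n = 0) : ∃ t, n = pos f t ∧ half f t = 0 := by
  rcases h.cover n with ⟨t, rfl⟩ | ⟨t, h1, rfl⟩
  · exact ⟨t, rfl, hn⟩
  · have := (h.apply_pos_add_one h1).1; omega

lemma pos_add_congr {i j n : ℕ} (hij : ∀ t < n, half f (j + t) = half f (i + t)) :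
    pos f (j + n) + pos f i = pos f (i + n) + pos f j := by
  have h1 := pre_add_congr hij n le_rfl
  have h2 := (h.pos_eq_pre (j + n)).1
  have h3 := (h.pos_eq_pre (i + n)).1
  have h4 := (h.pos_eq_pre j).1
  have h5 := (h.pos_eq_pre i).1
  push_cast at h2 h3
  omega

lemma ultPer (hu : UltPer (half f)) : UltPer f := by
  obtain ⟨M, T, hT, hu⟩ := hu
  have hlt := h.pos_strictMono (show M < M + T by omega)
  have hs : ∀ t, M ≤ t → pos f (t + T) = pos f t + (pos f (M + T) - pos f M) := by
    intro t ht
    have := h.pos_add_congr (i := M) (j := M + T) (n := t - M) fun s _ => by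
      rw [show M + T + s = M + s + T by omega, hu _ (by omega)]
    rw [show M + T + (t - M) = t + T by omega, show M + (t - M) = t by omega] at this
    omega
  refine ⟨pos f M, pos f (M + T) - pos f M, by omega, fun n hn => ?_⟩
  rcases h.cover n with ⟨t, rfl⟩ | ⟨t, h1, rfl⟩
  · have ht := h.pos_strictMono.le_iff_le.1 hn
    rw [← hs t ht]
    exact hu t ht
  · have ht : M ≤ t := by
      by_contra hlt
      have h2 := h.pos_strictMono.monotone (show t + 1 ≤ M by omega)
      rw [h.pos_succ_one h1] at h2
      omega
    rw [(h.apply_pos_add_one h1).1, add_right_comm, ← hs t ht]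
    exact (h.apply_pos_add_one ((hu t ht).trans h1)).1

lemma half_rec (hf : Good f) (i n M : ℕ) :
    ∃ j, M ≤ j ∧ ∀ t < n, half f (j + t) = half f (i + t) := by
  obtain ⟨x, hx, hx0⟩ := hf.exists_eq (pos f (i + n)) (c := 0) (by omega)
  obtain ⟨q, rfl, hq⟩ := h.exists_pos_of_zero hx0
  have hnq := h.pos_strictMono.le_iff_le.1 hx
  have hiq := h.pos_strictMono.monotone (show i ≤ q by omega)
  obtain ⟨X, hX, hr⟩ := hf.rec_ (pos f i) (pos f q - pos f i + 1) (pos f M)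
  have h1 := pre_add_congr hr (pos f q - pos f i) (by omega)
  have h2 := hr (pos f q - pos f i) (by omega)
  rw [show pos f i + (pos f q - pos f i) = pos f q by omega] at h1 h2
  have h3 : ¬ Odd (pre f (X + (pos f q - pos f i))) := fun ho => by
    have := h.odd _ ho; omega
  rw [Int.not_odd_iff_even] at h3
  have h4 := (h.pos_eq_pre q).2
  have h5 := (h.pos_eq_pre i).2
  obtain ⟨j, rfl⟩ := h.exists_pos (n := X) (by
    have : pre f X = pre f (X + (pos f q - pos f i)) -
      2 * (pre (half f) q - pre (half f) i) := by omega
    rw [this]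
    exact h3.sub (even_two_mul _))
  refine ⟨j, h.pos_strictMono.le_iff_le.1 hX, ?_⟩
  suffices key : ∀ k ≤ q - i, ∀ t < k, half f (j + t) = half f (i + t) from
    fun t ht => key (q - i) le_rfl t (by omega)
  intro k
  induction k with
  | zero => intro _ t ht; omega
  | succ k ih =>
    intro hk t ht
    rcases Nat.lt_succ_iff_lt_or_eq.1 ht with h6 | rfl
    · exact ih (by omega) t h6
    · have h7 := h.pos_add_congr (ih (by omega))
      have h8 := h.pos_strictMono.monotone (show i ≤ i + t by omega)
      have h9 := h.pos_strictMono (show i + t < q by omega)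
      have h10 := hr (pos f (i + t) - pos f i) (by omega)
      rw [show pos f i + (pos f (i + t) - pos f i) = pos f (i + t) by omega,
        show pos f j + (pos f (i + t) - pos f i) = pos f (j + t) by omega] at h10
      exact h10

lemma win_pos {N : ℕ} {c : ℤ} {N' : ℕ} (hN : (N' : ℤ) = N + c) (s : ℕ) :
    win f N' (pos f s) = 2 * c ↔ win (half f) N s = c := by
  have h1 := h.pos_eq_pre s
  simp only [win]
  constructor
  · intro h2
    obtain ⟨s', hs'⟩ := h.exists_pos (n := pos f s + N') ⟨pre (half f) s + c, by omega⟩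
    have h3 := h.pos_eq_pre s'
    rw [hs', h3.2, h1.2] at h2
    obtain rfl : s' = s + N := by omega
    omega
  · intro h2
    have h3 := h.pos_eq_pre (s + N)
    push_cast at h3
    have h4 : pos f s + N' = pos f (s + N) := by omega
    rw [h4, h3.2, h1.2]
    omega

lemma win_pos_add_one {N : ℕ} {c : ℤ} {N' : ℕ} (hN : (N' : ℤ) = N + c) {s : ℕ} (hs : half f s = 1) :
    win f N' (pos f s + 1) = 2 * c ↔ win (half f) N s = c ∧ half f (s + N) = 1 := by
  have h0 := h.pos_eq_pre s
  have h1 := h.apply_pos_add_one hs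
  simp only [win]
  constructor
  · intro h2
    obtain ⟨s', hs1, hs'⟩ := h.exists_pos_add_one (n := pos f s + 1 + N')
      ⟨pre (half f) s + c, by omega⟩
    have h3 := h.pos_eq_pre s'
    have h4 := h.apply_pos_add_one hs1
    rw [hs', h4.2, h1.2] at h2
    obtain rfl : s' = s + N := by omega
    exact ⟨by omega, hs1⟩
  · rintro ⟨h2, h2'⟩
    have h3 := h.pos_eq_pre (s + N)
    have h5 := h.apply_pos_add_one h2'
    push_cast at h3
    have h4 : pos f s + 1 + N' = pos f (s + N) + 1 := by omega
    rw [h4, h5.2, h1.2]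
    omega

lemma isRet_pos {N : ℕ} {c : ℤ} {N' : ℕ} (hN : (N' : ℤ) = N + c) {t d : ℕ}
    (hr : IsRet (half f) N t d) (hc : win (half f) N t = c)
    (hb : ¬ (half f t = 1 ∧ half f (t + N) = 1)) :
    IsRet f N' (pos f t) (pos f (t + d) - pos f t) := by
  obtain ⟨hd, h1, h2⟩ := hr
  have hlt := h.pos_strictMono (show t < t + d by omega)
  have e1 := (h.win_pos hN t).2 hc
  refine ⟨by omega, ?_, fun k hk hk' he => ?_⟩
  · rw [show pos f t + (pos f (t + d) - pos f t) = pos f (t + d) by omega, e1]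
    exact (h.win_pos hN _).2 (h1.trans hc)
  · rw [e1] at he
    rw [show pos f t + (pos f (t + d) - pos f t) = pos f (t + d) by omega] at hk'
    rcases h.cover k with ⟨s, rfl⟩ | ⟨s, hs, rfl⟩
    · exact h2 s (h.pos_strictMono.lt_iff_lt.1 hk) (h.pos_strictMono.lt_iff_lt.1 hk')
        (((h.win_pos hN s).1 he).trans hc.symm)
    · obtain ⟨e2, e3⟩ := (h.win_pos_add_one hN hs).1 he
      rcases (h.pos_strictMono.le_iff_le.1
        (show pos f t ≤ pos f s by omega)).eq_or_lt with rfl | hts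
      · exact hb ⟨hs, e3⟩
      · exact h2 s hts (h.pos_strictMono.lt_iff_lt.1 (by omega)) (e2.trans hc.symm)

lemma half_ret (hf : Good f) (N : ℕ) (c : ℤ) : (retVecs (half f) N c).encard ≤ 3 := by
  rcases (retVecs (half f) N c).eq_empty_or_nonempty with he | ⟨_, i, -, hi, -⟩
  · simp [he]
  have hmono : ∀ i n, 0 ≤ pre (half f) (i + n) - pre (half f) i := by
    intro i n
    have h1 := (h.pos_eq_pre (i + n)).1
    have h2 := (h.pos_eq_pre i).1
    induction n with
    | zero => simp
    | succ n ih =>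
      have h3 := h.half_bin (i + n)
      rw [← add_assoc, pre_succ]
      have := ih (h.pos_eq_pre _).1
      omega
  have hc : 0 ≤ c := hi ▸ hmono i N
  obtain ⟨N', hN⟩ : ∃ N' : ℕ, (N' : ℤ) = N + c := ⟨N + c.toNat, by omega⟩
  let φ : ℕ × ℤ → ℕ × ℤ := fun v => if v = (1, 1) then (1, 1) else ((v.1 + v.2).toNat, 2 * v.2)
  have hpos : ∀ v ∈ retVecs (half f) N c, 0 ≤ v.2 := by
    rintro v ⟨i, -, -, h3⟩
    exact h3 ▸ hmono i v.1
  have hinj : Set.InjOn φ (retVecs (half f) N c) := by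
    rintro ⟨d, p⟩ hv ⟨d', p'⟩ hv' hφ
    have h1 := hpos _ hv
    have h2 := hpos _ hv'
    simp only [φ] at hφ h1 h2
    split_ifs at hφ with h3 h4 h4
    · rw [h3, h4]
    · simp only [Prod.mk.injEq] at hφ; omega
    · simp only [Prod.mk.injEq] at hφ; omega
    · simp only [Prod.mk.injEq] at hφ ⊢; omega
  rw [← hinj.encard_image]
  refine (Set.encard_le_encard ?_).trans (hf.ret N' (2 * c))
  rintro _ ⟨⟨d, p⟩, ⟨t, hr, hc, hp⟩, rfl⟩
  simp only at hr hp
  by_cases hb : half f t = 1 ∧ half f (t + N) = 1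
  · obtain rfl : d = 1 := by
      by_contra hd
      have := (isRet_one (hb.2.trans hb.1.symm)).2.1
      exact hr.2.2 (t + 1) (by omega) (by have := hr.1; omega) this
    have hp1 : p = 1 := by rw [hp, pre_succ, hb.1]; ring
    simp only [φ, hp1, if_true]
    refine mem_retVecs (i := pos f t) ?_ ?_ ?_
    · exact ⟨one_pos, by rw [(h.win_pos hN t).2 hc, (h.win_pos_add_one hN hb.1).2 ⟨hc, hb.2⟩],
        fun k _ _ => by omega⟩
    · rw [(h.win_pos hN t).2 hc]
    · rw [(h.apply_pos_add_one hb.1).2, (h.pos_eq_pre t).2]; ring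
  · have hne : ((d, p) : ℕ × ℤ) ≠ (1, 1) := by
      rintro h1
      obtain ⟨rfl, rfl⟩ := Prod.mk.inj h1
      rw [pre_succ] at hp
      have h2 := hr.2.1
      rw [win_succ] at h2
      exact hb ⟨by omega, by omega⟩
    simp only [φ, hne, if_false]
    have h1 := h.pos_eq_pre (t + d)
    have h2 := h.pos_eq_pre t
    have hlt := h.pos_strictMono.monotone (show t ≤ t + d by omega)
    have h3 : (d + p).toNat = pos f (t + d) - pos f t := by push_cast at h1; omega
    rw [h3]
    refine mem_retVecs (h.isRet_pos hN hr hc hb) ((h.win_pos hN t).2 hc) ?_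
    rw [show pos f t + (pos f (t + d) - pos f t) = pos f (t + d) by omega]
    omega

lemma good_half (hf : Good f) : Good (half f) where
  bin := h.half_bin
  ret := h.half_ret hf
  rec_ := h.half_rec hf
  not_ultPer hu := hf.not_ultPer (h.ultPer hu)

lemma zRun_pos {m i : ℕ} (hr : ZRun (half f) m i) : ZRun f m (pos f i + 1) := by
  obtain ⟨h1, h2, h3, h4⟩ := hr
  have hp : ∀ s ≤ m, pos f (i + 1 + s) = pos f i + 2 + s := by
    intro s
    induction s with
    | zero => exact fun _ => h.pos_succ_one h2
    | succ s ih =>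
      intro hs
      rw [← add_assoc, h.pos_succ_zero (h3 _ (by omega) (by omega)), ih (by omega)]
      rfl
  refine ⟨h1, (h.apply_pos_add_one h2).1, fun t ht ht' => ?_, ?_⟩
  · have h5 := h3 (i + 1 + (t - pos f i - 2)) (by omega) (by omega)
    rw [half, hp _ (by omega)] at h5
    rwa [show t = pos f i + 2 + (t - pos f i - 2) by omega]
  · rw [half, show i + m + 1 = i + 1 + m by omega, hp m le_rfl] at h4
    rwa [show pos f i + 1 + m + 1 = pos f i + 2 + m by omega]

lemma oRun_pos {k i : ℕ} (hr : ORun (half f) k i) : ORun f (2 * k) (pos f i) := by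
  obtain ⟨h1, h2, h3, h4⟩ := hr
  have hp : ∀ s ≤ k, pos f (i + 1 + s) = pos f i + 1 + 2 * s := by
    intro s
    induction s with
    | zero => exact fun _ => h.pos_succ_zero h2
    | succ s ih =>
      intro hs
      rw [← add_assoc, h.pos_succ_one (h3 _ (by omega) (by omega)), ih (by omega)]
      ring
  refine ⟨by omega, h2, fun t ht ht' => ?_, ?_⟩
  · obtain ⟨s, hs | hs⟩ : ∃ s, t = pos f i + 1 + 2 * s ∨ t = pos f i + 1 + 2 * s + 1 :=
      ⟨(t - pos f i - 1) / 2, by omega⟩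
    · have h5 := h3 (i + 1 + s) (by omega) (by omega)
      rwa [half, hp _ (by omega), ← hs] at h5
    · have h5 := h.apply_pos_add_one (h3 (i + 1 + s) (by omega) (by omega))
      rw [hp _ (by omega), ← hs] at h5
      exact h5.1
  · rw [half, show i + k + 1 = i + 1 + k by omega, hp k le_rfl] at h4
    rwa [show pos f i + 2 * k + 1 = pos f i + 1 + 2 * k by omega]

end Paired

lemma exists_last_zero (hb : ∀ n, f n = 0 ∨ f n = 1) (h0 : f 0 = 0) (n : ℕ) :
    ∃ i ≤ n, f i = 0 ∧ ∀ t, i < t → t ≤ n → f t = 1 := by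
  induction n with
  | zero => exact ⟨0, le_rfl, h0, fun t _ _ => by omega⟩
  | succ n ih =>
    rcases hb (n + 1) with h | h
    · exact ⟨n + 1, le_rfl, h, fun t _ _ => by omega⟩
    · obtain ⟨i, h1, h2, h3⟩ := ih
      refine ⟨i, by omega, h2, fun t h4 h5 => ?_⟩
      rcases h5.eq_or_lt with rfl | h6
      · exact h
      · exact h3 t h4 (by omega)

lemma paired_of_even (hb : ∀ n, f n = 0 ∨ f n = 1) (h0 : f 0 = 0)
    (he : ∀ x i, ORun f x i → Even x) : Paired f := by
  refine ⟨hb, fun n hn => (hb n).resolve_left fun hn0 => ?_⟩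
  induction n using Nat.strong_induction_on with
  | _ n ih =>
    rcases Nat.eq_zero_or_pos n with rfl | h1
    · rw [pre_zero] at hn; exact absurd hn (by decide)
    obtain ⟨i, h2, h3, h4⟩ := exists_last_zero hb h0 (n - 1)
    refine ih i (by omega) ?_ h3
    have h5 := pre_add_ones (f := f) (i := i + 1) (k := n - 1 - i) fun t a b =>
      h4 t (by omega) (by omega)
    rw [show i + 1 + (n - 1 - i) = n by omega, pre_succ, h3] at h5
    rcases Nat.eq_zero_or_pos (n - 1 - i) with h6 | h6
    · rw [h6] at h5
      rwa [show pre f i = pre f n by rw [h5]; simp]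
    · obtain ⟨r, hr⟩ := he (n - 1 - i) i ⟨h6, h3, fun t a b => h4 t a (by omega), by
        rwa [show i + (n - 1 - i) + 1 = n by omega]⟩
      rw [show pre f i = pre f n - 2 * r by rw [h5, hr]; push_cast; ring]
      exact hn.sub_even (even_two_mul _)

lemma zRun_shift {m i s : ℕ} : ZRun (fun k => f (k + s)) m i ↔ ZRun f m (i + s) := by
  simp only [ZRun]
  rw [show i + m + 1 + s = i + s + m + 1 by omega]
  refine and_congr_right fun _ => and_congr_right fun _ => and_congr_left fun _ =>
    ⟨fun h t h1 h2 => ?_, fun h t h1 h2 => h _ (by omega) (by omega)⟩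
  have := h (t - s) (by omega) (by omega)
  rwa [Nat.sub_add_cancel (by omega)] at this

lemma oRun_shift {m i s : ℕ} : ORun (fun k => f (k + s)) m i ↔ ORun f m (i + s) := by
  rw [← zRun_flip, ← zRun_flip, ← zRun_shift (f := flip f)]
  rfl

lemma ORun.unique {k l i : ℕ} (hk : ORun f k i) (hl : ORun f l i) : k = l := by
  obtain ⟨-, -, h3, h4⟩ := hk
  obtain ⟨-, -, h3', h4'⟩ := hl
  rcases lt_trichotomy k l with h | h | h
  · have := h3' (i + k + 1) (by omega) (by omega); omega
  · exact h
  · have := h3 (i + l + 1) (by omega) (by omega); omega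

lemma ZRun.unique {k l i : ℕ} (hk : ZRun f k i) (hl : ZRun f l i) : k = l :=
  (oRun_flip.2 hk).unique (oRun_flip.2 hl)

/-- If all blocks of ones have even length, these lengths can be halved. -/
lemma Good.exists_half (hf : Good f) (he : ∀ x i, ORun f x i → Even x) :
    ∃ v, Good v ∧ (∀ x, (∃ i, ZRun v x i) ↔ ∃ i, ZRun f x i) ∧
      ∀ x, (∃ i, ORun v x i) ↔ ∃ i, ORun f (2 * x) i := by
  obtain ⟨s, -, hs⟩ := hf.exists_eq 0 (c := 0) (by omega)
  let g : ℕ → ℤ := fun k => f (k + s)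
  have hg : Good g := hf.shift s
  have hz : ∀ x, (∃ i, ZRun g x i) ↔ ∃ i, ZRun f x i := fun x =>
    ⟨fun ⟨i, hi⟩ => ⟨_, zRun_shift.1 hi⟩, fun ⟨i, hi⟩ => by
      obtain ⟨j, hj, h⟩ := hf.zRun_rec hi s
      exact ⟨j - s, zRun_shift.2 (by rwa [Nat.sub_add_cancel hj])⟩⟩
  have ho : ∀ x, (∃ i, ORun g x i) ↔ ∃ i, ORun f x i := fun x =>
    ⟨fun ⟨i, hi⟩ => ⟨_, oRun_shift.1 hi⟩, fun ⟨i, hi⟩ => by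
      obtain ⟨j, hj, h⟩ := hf.oRun_rec hi s
      exact ⟨j - s, oRun_shift.2 (by rwa [Nat.sub_add_cancel hj])⟩⟩
  have hp : Paired g := paired_of_even hg.bin (by simpa [g] using hs)
    fun x i hi => he _ _ (oRun_shift.1 hi)
  have hv := hp.good_half hg
  refine ⟨half g, hv, fun x => ?_, fun x => ?_⟩
  · rw [← hz]
    refine ⟨fun ⟨i, hi⟩ => ⟨_, hp.zRun_pos hi⟩, fun ⟨i, hi⟩ => ?_⟩
    obtain ⟨h1, h2, h3, h4⟩ := id hi
    obtain ⟨t, ht, ht0⟩ := hp.exists_pos_of_zero (h3 (i + 1) (by omega) (by omega))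
    cases t with
    | zero => simp [pos] at ht
    | succ t =>
      rcases hp.half_bin t with h5 | h5
      · rw [hp.pos_succ_zero h5] at ht
        obtain rfl : i = pos g t := by omega
        have : g (pos g t) = 0 := h5
        omega
      · rw [hp.pos_succ_one h5] at ht
        obtain rfl : i = pos g t + 1 := by omega
        obtain ⟨y, hy⟩ := hv.exists_zRun_at h5 ht0
        rw [hi.unique (hp.zRun_pos hy)]
        exact ⟨t, hy⟩
  · rw [← ho]
    refine ⟨fun ⟨i, hi⟩ => ⟨_, hp.oRun_pos hi⟩, fun ⟨i, hi⟩ => ?_⟩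
    obtain ⟨h1, h2, h3, h4⟩ := id hi
    obtain ⟨t, rfl, ht0⟩ := hp.exists_pos_of_zero h2
    obtain ⟨y, hy⟩ := hv.exists_oRun_at ht0 (by
      rw [half, hp.pos_succ_zero ht0]; exact h3 _ (by omega) (by omega))
    have := hi.unique (hp.oRun_pos hy)
    obtain rfl : x = y := by omega
    exact ⟨t, hy⟩

lemma TwoRun.flip {m k : ℕ} (h : TwoRun f m k) : TwoRun (BinWord.flip f) k m where
  m_ne := h.k_ne
  k_ne := h.m_ne
  zeros x i hx := h.ones x i (zRun_flip.1 hx)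
  ones x i hx := h.zeros x i (oRun_flip.1 hx)
  z_two := h.o_two.imp fun _ => zRun_flip.2
  z_m := h.o_k.imp fun _ => zRun_flip.2
  o_two := h.z_two.imp fun _ => oRun_flip.2
  o_k := h.z_m.imp fun _ => oRun_flip.2

lemma TwoRun.exists_half (hf : Good f) {m : ℕ} (h : TwoRun f m 4) : ∃ v, Good v ∧ TwoRun v m 1 := by
  obtain ⟨v, hv, hz, ho⟩ := hf.exists_half fun x i hx => by
    rcases h.ones x i hx with rfl | rfl <;> decide
  refine ⟨v, hv, h.m_ne, by decide, fun x i hx => ?_, fun x i hx => ?_, (hz 2).2 h.z_two,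
    (hz m).2 h.z_m, (ho 2).2 h.o_k, (ho 1).2 h.o_two⟩
  · obtain ⟨j, hj⟩ := (hz x).1 ⟨i, hx⟩
    exact h.zeros x j hj
  · obtain ⟨j, hj⟩ := (ho x).1 ⟨i, hx⟩
    have := h.ones _ j hj
    omega

lemma TwoRun.exists_step_one (hf : Good f) (h : TwoRun f 1 1)
    (hB : ∃ i, win f 3 i = 2 ∧ f i = 1 ∧ f (i + 3) = 1) :
    ∃ i, win f 3 i = 1 ∧ f i = 0 ∧ f (i + 3) = 0 := by
  by_contra! hA
  have hA' : ∀ i, f i = 0 → f (i + 1) + f (i + 2) = 1 → f (i + 3) = 1 := fun i h1 h2 =>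
    (hf.bin _).resolve_left (hA i (by rw [win_three]; omega) h1)
  have hpre : ∀ i, 1 ≤ i → f i + f (i + 1) = 1 → f (i + 2) = 0 → f (i - 1) = 1 := by
    intro i h1 h2 h3
    refine (hf.bin _).resolve_left fun h4 => ?_
    have := hA' (i - 1) h4 (by
      rw [show i - 1 + 1 = i by omega, show i - 1 + 2 = i + 1 by omega]; exact h2)
    rw [show i - 1 + 3 = i + 2 by omega] at this
    omega
  obtain ⟨b, hb, hb0, hb3⟩ := hB
  obtain ⟨a, -, ha0, ha1, ha2⟩ := h.o_two
  have a1 := ha1 (a + 1) (by omega) (by omega)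
  have a2 := ha1 (a + 2) (by omega) (by omega)
  have huniq := fun i j d d' => hf.ret_unique (N := 3) (c := 2) (i := a) (j := b) (i' := i)
    (j' := j) (d := d) (d' := d') ⟨ha0, ha2, by rw [win_three]; omega⟩ ⟨hb0, hb3, hb⟩
  obtain ⟨p, hp⟩ := h.o_k
  obtain ⟨p, hp1, -, h1, h2, h3⟩ := hf.oRun_rec hp 1
  have h4 := h2 (p + 1) (by omega) (by omega)
  have h5 := hA' p h1 (by rw [h4, h3]; rfl)
  have h6 := hpre p hp1 (by rw [h1, h4]; rfl) h3
  obtain ⟨q, hq⟩ := h.z_two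
  obtain ⟨q, hq1, -, g1, g2, g3⟩ := hf.zRun_rec hq 1
  have g4 := g2 (q + 1) (by omega) (by omega)
  have g5 := g2 (q + 2) (by omega) (by omega)
  have g6 := hA' (q + 1) g4 (by
    rw [add_assoc, add_assoc]; show f (q + 2) + f (q + 2 + 1) = 1; omega)
  have g7 := hpre q hq1 (by rw [g1, g4]; rfl) g5
  obtain ⟨p, rfl⟩ : ∃ p', p = p' + 1 := ⟨p - 1, by omega⟩
  obtain ⟨q, rfl⟩ : ∃ q', q = q' + 1 := ⟨q - 1, by omega⟩
  simp only [add_assoc, Nat.reduceAdd, Nat.add_sub_cancel] at *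
  have := huniq p q 2 3
    ⟨by omega, by simp only [win_three, add_assoc, Nat.reduceAdd]; omega, fun k k1 k2 => by
      obtain rfl : k = p + 1 := by omega
      simp only [win_three, add_assoc, Nat.reduceAdd]; omega⟩
    (by simp only [win_three, add_assoc]; omega) (by omega)
    ⟨by omega, by simp only [win_three, add_assoc, Nat.reduceAdd]; omega, fun k k1 k2 => by
      rcases (show k = q + 1 ∨ k = q + 2 by omega) with rfl | rfl <;>
      simp only [win_three, add_assoc, Nat.reduceAdd] <;> omega⟩
    (by simp only [win_three, add_assoc]; omega) (by omega)
  omega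

lemma TwoRun.false_of_one (hf : Good f) (h : TwoRun f 1 1) : False := by
  have hl : ∀ i, win f 3 i = 1 ∨ win f 3 i = 1 + 1 := by
    intro i
    have b0 := hf.bin i
    have b1 := hf.bin (i + 1)
    have b2 := hf.bin (i + 2)
    have h0 : ¬ (f i = 0 ∧ f (i + 1) = 0 ∧ f (i + 2) = 0) := fun ⟨h0, h1, h2⟩ => by
      obtain ⟨k, j, h3, h4⟩ := hf.exists_zRun_ge (n := 3) (i := i) (by omega) fun t ht => by
        interval_cases t <;> assumption
      have := h.zeros _ _ h3; omega
    have h1 : ¬ (f i = 1 ∧ f (i + 1) = 1 ∧ f (i + 2) = 1) := fun ⟨h0, h1, h2⟩ => by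
      obtain ⟨k, j, h3, h4⟩ := hf.exists_oRun_ge (n := 3) (i := i) (by omega) fun t ht => by
        interval_cases t <;> assumption
      have := h.ones _ _ h3; omega
    rw [win_three]; omega
  have hboth : ((∃ i, win f 3 i = 2 ∧ f i = 1 ∧ f (i + 3) = 1) ∧
      ∃ i, win f 3 i = 1 ∧ f i = 0 ∧ f (i + 3) = 0) := by
    by_cases hB : ∃ i, win f 3 i = 2 ∧ f i = 1 ∧ f (i + 3) = 1
    · exact ⟨hB, h.exists_step_one hf hB⟩
    by_cases hA : ∃ i, win f 3 i = 1 ∧ f i = 0 ∧ f (i + 3) = 0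
    · refine ⟨?_, hA⟩
      obtain ⟨i, h1, h2, h3⟩ := hA
      obtain ⟨j, h4, h5, h6⟩ := h.flip.exists_step_one hf.flip
        ⟨i, by rw [win_flip]; push_cast; omega,
        by simp [BinWord.flip, h2], by simp [BinWord.flip, h3]⟩
      rw [win_flip] at h4; push_cast at h4
      simp only [BinWord.flip] at h5 h6
      exact ⟨j, by omega, by omega, by omega⟩
    exfalso
    push Not at hA hB
    obtain ⟨p, -, h1, h2, h3⟩ := h.o_k
    have h4 := h2 (p + 1) (by omega) (by omega)
    have key : ∀ s, f (p + 2 * s) = 0 ∧ f (p + 2 * s + 1) = 1 ∧ f (p + 2 * s + 2) = 0 := by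
      intro s
      induction s with
      | zero => exact ⟨h1, h4, h3⟩
      | succ s ih =>
        obtain ⟨e1, e2, e3⟩ := ih
        have e4 := (hf.bin _).resolve_left (hA (p + 2 * s) (by rw [win_three]; omega) e1)
        have e5 := (hf.bin _).resolve_right (hB (p + 2 * s + 1)
          (by simp only [win_three, add_assoc, Nat.reduceAdd] at *; omega) e2)
        exact ⟨e3, e4, e5⟩
    refine hf.not_ultPer ⟨p, 2, by omega, fun n hn => ?_⟩
    obtain ⟨s, rfl | rfl⟩ : ∃ s, n = p + 2 * s ∨ n = p + 2 * s + 1 := ⟨(n - p) / 2, by omega⟩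
    · rw [(key s).1]; exact (key s).2.2
    · rw [(key s).2.1]; exact (key (s + 1)).2.1
  obtain ⟨⟨b, hb, hb0, hb3⟩, a, ha, ha0, ha3⟩ := hboth
  obtain ⟨p, -, p0, p1, p3⟩ := h.o_two
  obtain ⟨q, -, q0, q1, q3⟩ := h.z_two
  have p2 := p1 (p + 2) (by omega) (by omega)
  have q2 := q1 (q + 2) (by omega) (by omega)
  have p1 := p1 (p + 1) (by omega) (by omega)
  have q1 := q1 (q + 1) (by omega) (by omega)
  have hex : ∀ c, ∃ r, ∀ i d, (∀ j d', win f 3 i = c → 2 ≤ d → IsRet f 3 i d → win f 3 j = c →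
      2 ≤ d' → IsRet f 3 j d' → d = d') → win f 3 i = c → 2 ≤ d → IsRet f 3 i d → d = r := by
    intro c
    by_cases h0 : ∃ j d', win f 3 j = c ∧ 2 ≤ d' ∧ IsRet f 3 j d'
    · obtain ⟨j, d', e1, e2, e3⟩ := h0
      exact ⟨d', fun i d hu e4 e5 e6 => hu j d' e4 e5 e6 e1 e2 e3⟩
    · push Not at h0
      exact ⟨0, fun i d _ e4 e5 e6 => absurd e6 (h0 i d e4 e5)⟩
  obtain ⟨r, hr⟩ := hex 1
  obtain ⟨s, hs⟩ := hex (1 + 1)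
  refine hf.two_level (N := 3) (by omega) hl (r := r) (s := s)
    (fun i d => hr i d fun j d' e1 e2 e3 e4 e5 e6 => ?_)
    fun i d => hs i d fun j d' e1 e2 e3 e4 e5 e6 => ?_
  · exact hf.ret_unique ⟨ha0, ha3, ha⟩ ⟨q0, q3, by rw [win_three]; omega⟩ e3 e1 e2 e6 e4 e5
  · exact hf.ret_unique ⟨p0, p3, by rw [win_three]; omega⟩ ⟨hb0, hb3, hb⟩ e3 e1 e2 e6 e4 e5

lemma ORun.mem_three_one {x i : ℕ} (h : ORun f x (i + 1)) (hx : 2 ≤ x) (h0 : f i = 0)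
    (h1 : f (i + x + 3) = 0) : (x + 1, (x : ℤ) - 1) ∈ retVecs f 3 1 := by
  obtain ⟨-, g1, g2, g3⟩ := h
  have g4 := g2 (i + 2) (by omega) (by omega)
  have g5 := g2 (i + 3) (by omega) (by omega)
  have g6 := g2 (i + x + 1) (by omega) (by omega)
  rw [show i + 1 + x + 1 = i + x + 2 by omega] at g3
  have hw : win f 3 i = 1 := by rw [win_three, h0, g1, g4]; rfl
  refine mem_retVecs (i := i) ⟨by omega, ?_, fun k hk hk' => ?_⟩ hw ?_
  · rw [hw, win_three]
    simp only [← add_assoc] at *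
    rw [g6, show i + x + 1 + 1 = i + x + 2 by omega, g3,
      show i + x + 1 + 2 = i + x + 3 by omega, h1]
    rfl
  · rw [hw, win_three]
    rcases (show k = i + 1 ∨ i + 2 ≤ k by omega) with rfl | h2
    · simp only [add_assoc, Nat.reduceAdd]; omega
    · have h3 := g2 k (by omega) (by omega)
      have h4 := g2 (k + 1) (by omega) (by omega)
      have h5 : 0 ≤ f (k + 2) := by
        rcases (show k + 2 ≤ i + 1 + x ∨ k + 2 = i + x + 2 by omega) with h6 | h6
        · rw [g2 _ (by omega) h6]; decide
        · rw [h6, g3]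
      omega
  · have h2 := pre_add_ones (f := f) (i := i + 2) (k := x - 1) fun t a b =>
      g2 t (by omega) (by omega)
    have h3 := pre_succ (f := f) i
    have h4 := pre_succ (f := f) (i + 1)
    rw [show i + 2 + (x - 1) = i + (x + 1) by omega] at h2
    simp only [add_assoc, Nat.reduceAdd] at h4
    omega

lemma ZRun.mem_three_one {m i : ℕ} (h : ZRun f m i) (hm : 3 ≤ m) :
    (m - 1, (1 : ℤ)) ∈ retVecs f 3 1 := by
  obtain ⟨-, g1, g2, g3⟩ := h
  have z : ∀ s, 1 ≤ s → s ≤ m → f (i + s) = 0 := fun s _ _ => g2 _ (by omega) (by omega)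
  have hw : win f 3 i = 1 := by
    rw [win_three, g1, z 1 le_rfl (by omega), z 2 (by omega) (by omega)]; rfl
  refine mem_retVecs (i := i) ⟨by omega, ?_, fun k hk hk' => ?_⟩ hw ?_
  · rw [hw, win_three, show i + (m - 1) + 1 = i + m by omega,
      show i + (m - 1) + 2 = i + m + 1 by omega, z _ (by omega) (by omega),
      z _ (by omega) (by omega), g3]
    rfl
  · rw [hw, win_three, g2 _ (by omega) (by omega), g2 _ (by omega) (by omega),
      g2 _ (by omega) (by omega)]
    decide
  · have h2 := pre_add_zeros (f := f) (i := i + 1) (k := m - 2) fun t a b =>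
      g2 t (by omega) (by omega)
    rw [show i + 1 + (m - 2) = i + (m - 1) by omega, pre_succ, g1] at h2
    omega

lemma ZRun.mem_three_one_of_two {i : ℕ} (h : ZRun f 2 i) : (1, (1 : ℤ)) ∈ retVecs f 3 1 := by
  obtain ⟨-, g1, g2, g3⟩ := h
  exact one_mem_retVecs g1 g3 (by
    rw [win_three, g1, g2 _ (by omega) (by omega), g2 _ (by omega) (by omega)]; rfl)

lemma Good.exists_mem_three_one (hf : Good f) (hz : ∀ i, ¬ ZRun f 1 i) {x : ℕ} (hx : 2 ≤ x)
    (h : ∃ i, ORun f x i) : (x + 1, (x : ℤ) - 1) ∈ retVecs f 3 1 := by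
  obtain ⟨i, hi⟩ := h
  obtain ⟨i, hi1, hr⟩ := hf.oRun_rec hi 1
  obtain ⟨i, rfl⟩ : ∃ j, i = j + 1 := ⟨i - 1, by omega⟩
  obtain ⟨-, h2, h3, h4⟩ := id hr
  have h5 := h3 (i + 1 + 1) (by omega) (by omega)
  have h6 := h3 (i + 1 + x) (by omega) (by omega)
  refine hr.mem_three_one hx ?_ ?_
  · refine (hf.bin _).resolve_right fun h7 => hz i ⟨le_rfl, h7, fun t _ _ => ?_, h5⟩
    rwa [show t = i + 1 by omega]
  · refine (hf.bin _).resolve_right fun h7 => hz (i + 1 + x) ⟨le_rfl, h6, fun t _ _ => ?_, ?_⟩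
    · rwa [show t = i + 1 + x + 1 by omega]
    · rwa [show i + 1 + x + 1 + 1 = i + x + 3 by omega]

lemma TwoRun.pos {m k : ℕ} (h : TwoRun f m k) : 1 ≤ m ∧ 1 ≤ k := by
  obtain ⟨i, hi⟩ := h.z_m
  obtain ⟨j, hj⟩ := h.o_k
  exact ⟨hi.1, hj.1⟩

lemma TwoRun.eq_four (hf : Good f) {m k : ℕ} (h : TwoRun f m k) (hm : 3 ≤ m) (hk : 3 ≤ k) :
    m = 4 := by
  have hz : ∀ i, ¬ ZRun f 1 i := fun i hi => by have := h.zeros _ _ hi; omega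
  obtain ⟨i, hi⟩ := h.z_two
  obtain ⟨j, hj⟩ := h.z_m
  have := eq_of_encard_le_three (hf.ret 3 1) hi.mem_three_one_of_two (hj.mem_three_one hm)
    (hf.exists_mem_three_one hz le_rfl h.o_two) (hf.exists_mem_three_one hz (by omega) h.o_k)
  simp only [Prod.mk.injEq] at this
  omega

lemma TwoRun.eq_four_of_one (hf : Good f) {m : ℕ} (h : TwoRun f m 1) (hm : 3 ≤ m) : m = 4 := by
  have hz : ∀ i, ¬ ZRun f 1 i := fun i hi => by have := h.zeros _ _ hi; omega
  obtain ⟨i, hi⟩ := h.z_two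
  obtain ⟨j, hj⟩ := h.z_m
  obtain ⟨p, hp⟩ := h.o_k
  obtain ⟨p, hp1, -, p1, p2, p3⟩ := hf.oRun_rec hp 1
  obtain ⟨p, rfl⟩ : ∃ q, p = q + 1 := ⟨p - 1, by omega⟩
  have p4 := p2 (p + 2) (by omega) (by omega)
  have p5 : f p = 0 := (hf.bin _).resolve_right fun h7 => hz p ⟨le_rfl, h7, fun t _ _ => by
    rwa [show t = p + 1 by omega], p4⟩
  have := eq_of_encard_le_three (hf.ret 3 1) hi.mem_three_one_of_two (hj.mem_three_one hm)
    (hf.exists_mem_three_one hz le_rfl h.o_two)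
    (one_mem_retVecs (N := 3) p5 p3 (by rw [win_three, p5, p1, p4]; rfl))
  simp only [Prod.mk.injEq] at this
  omega

lemma TwoRun.false (hf : Good f) {m k : ℕ} (h : TwoRun f m k) : False := by
  have h41 : ∀ {g : ℕ → ℤ}, Good g → TwoRun g 4 1 → False := fun hg hr => by
    obtain ⟨v, hv, hr'⟩ := hr.flip.exists_half hg.flip
    exact hr'.false_of_one hv
  obtain ⟨h1, h2⟩ := h.pos
  have h3 := h.m_ne
  have h4 := h.k_ne
  rcases (show m = 1 ∨ 3 ≤ m by omega) with rfl | hm <;>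
  rcases (show k = 1 ∨ 3 ≤ k by omega) with rfl | hk
  · exact h.false_of_one hf
  · obtain rfl := h.flip.eq_four_of_one hf.flip hk
    exact h41 hf.flip h.flip
  · obtain rfl := h.eq_four_of_one hf hm
    exact h41 hf h
  · obtain rfl := h.eq_four hf hm hk
    obtain rfl := h.flip.eq_four hf.flip hk hm
    obtain ⟨v, hv, hr⟩ := h.exists_half hf
    exact h41 hv hr

lemma Good.balanced (hf : Good f) : Balanced f := by
  rcases hf.run_cases with ⟨j, m, l, h⟩ | ⟨j, m, l, h⟩ | ⟨m, k, h⟩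
  · exact hf.balanced_of_oneRun h
  · have := hf.flip.balanced_of_oneRun h
    intro n i j
    have := this n j i
    rw [win_flip, win_flip] at this
    omega
  · exact (h.false hf).elim

section Factors

variable {β : Type*}

lemma factorAt_eq_iff {w : ℕ → β} {i j n : ℕ} :
    factorAt w i n = factorAt w j n ↔ ∀ t < n, w (i + t) = w (j + t) := by
  simp [factorAt, List.map_inj_left]

lemma factorAt_succ (w : ℕ → β) (i n : ℕ) :
    factorAt w i (n + 1) = factorAt w i n ++ [w (i + n)] := by
  simp [factorAt, List.range_succ]

@[simp] lemma length_factorAt (w : ℕ → β) (i n : ℕ) : (factorAt w i n).length = n := by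
  simp [factorAt]

lemma setOf_isFactor (w : ℕ → β) (n : ℕ) :
    {u : List β | u.length = n ∧ IsFactor w u} = Set.range fun i => factorAt w i n := by
  ext u
  constructor
  · rintro ⟨rfl, i, hi⟩
    exact ⟨i, hi⟩
  · rintro ⟨i, rfl⟩
    exact ⟨length_factorAt w i n, i, by rw [length_factorAt]⟩

lemma isFactor_factorAt (w : ℕ → β) (i n : ℕ) : IsFactor w (factorAt w i n) :=
  ⟨i, by rw [length_factorAt]⟩

end Factors

/-- A balanced word has at most one right special factor of each length. -/
lemma Balanced.right_special_unique (hf : Balanced f) (hb : ∀ n, f n = 0 ∨ f n = 1)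
    {n i i' j j' : ℕ}
    (hi : ∀ t < n, f (i + t) = f (i' + t)) (hi0 : f (i + n) = 0) (hi1 : f (i' + n) = 1)
    (hj : ∀ t < n, f (j + t) = f (j' + t)) (hj0 : f (j + n) = 0) (hj1 : f (j' + n) = 1) :
    ∀ t < n, f (i + t) = f (j + t) := by
  suffices h : ∀ k ≤ n, ∀ t, n - k ≤ t → t < n → f (i + t) = f (j + t) from
    fun t ht => h n le_rfl t (by omega) ht
  intro k
  induction k with
  | zero => intro _ t h1 h2; omega
  | succ k ih =>
    intro hk t h1 h2
    rcases Nat.lt_or_ge t (n - k) with h3 | h3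
    swap
    · exact ih (by omega) t h3 h2
    by_contra hne
    have key : ∀ {a a' : ℕ}, f (a + t) = 0 → f (a + n) = 0 → f (a' + t) = 1 → f (a' + n) = 1 →
        (∀ s, t < s → s < n → f (a + s) = f (a' + s)) → False := by
      intro a a' g1 g2 g3 g4 g5
      have h4 := pre_add_congr (f := f) (i := a + t + 1) (j := a' + t + 1) (n := n - t - 1)
        (fun s hs => by
          have := g5 (t + 1 + s) (by omega) (by omega)
          rw [show a + t + 1 + s = a + (t + 1 + s) by omega, this]
          congr 1; omega) _ le_rfl
      have h5 := hf (n + 1 - t) (a + t) (a' + t)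
      simp only [win, show a + t + (n + 1 - t) = a + n + 1 by omega,
        show a' + t + (n + 1 - t) = a' + n + 1 by omega] at h5
      rw [show a + t + 1 + (n - t - 1) = a + n by omega,
        show a' + t + 1 + (n - t - 1) = a' + n by omega] at h4
      simp only [pre_succ] at h4 h5
      omega
    have hs : ∀ s, t < s → s < n → f (i + s) = f (j + s) := fun s h4 h5 =>
      ih (by omega) s (by omega) h5
    have e1 := hi t h2
    have e2 := hj t h2
    rcases hb (i + t) with h4 | h4 <;> rcases hb (j + t) with h5 | h5
    · omega
    · exact key h4 hi0 (by omega) hj1 fun s h6 h7 => (hs s h6 h7).trans (hj s h7)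
    · exact key h5 hj0 (by omega) hi1 fun s h6 h7 => (hs s h6 h7).symm.trans (hi s h7)
    · omega

/-- Balanced words that are not ultimately periodic have complexity `n + 1`. -/
lemma Balanced.complexity (hf : Balanced f) (hb : ∀ n, f n = 0 ∨ f n = 1) (hu : ¬ UltPer f)
    (n : ℕ) : (Set.range fun i => factorAt f i n).Finite ∧
      (Set.range fun i => factorAt f i n).ncard = n + 1 := by
  classical
  induction n with
  | zero => simp [factorAt]
  | succ n ih =>
    obtain ⟨hfin, hcard⟩ := ih
    obtain ⟨i, i', hi, hi0, hi1⟩ :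
        ∃ i i', (∀ t < n, f (i + t) = f (i' + t)) ∧ f (i + n) = 0 ∧ f (i' + n) = 1 := by
      by_contra! h
      refine hu (ultPer_of_deterministic hb (N := n) (L := 0) fun i j _ _ hij => ?_)
      have h1 := h i j hij
      have h2 := h j i fun t ht => (hij t ht).symm
      have := hb (i + n)
      have := hb (j + n)
      omega
    let e : List ℤ → ℤ := fun u =>
      if u ++ [1] ∈ Set.range fun i => factorAt f i (n + 1) then 1 else 0
    have hinj : Function.Injective fun u : List ℤ => u ++ [e u] := fun u v h =>
      (List.append_inj' h rfl).1
    have hmem : factorAt f i n ++ [1] ∈ Set.range fun i => factorAt f i (n + 1) :=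
      ⟨i', by simp only [factorAt_succ, hi1, factorAt_eq_iff.2 hi]⟩
    have hR : (Set.range fun i => factorAt f i (n + 1)) = insert (factorAt f i n ++ [0])
        ((fun u => u ++ [e u]) '' Set.range fun i => factorAt f i n) := by
      ext v
      constructor
      · rintro ⟨k, rfl⟩
        simp only [factorAt_succ]
        by_cases h : factorAt f k n ++ [1] ∈ Set.range fun i => factorAt f i (n + 1)
        · rcases hb (k + n) with h0 | h1
          · left
            obtain ⟨k', hk'⟩ := h
            simp only [factorAt_succ] at hk'
            obtain ⟨h2, h3⟩ := List.append_inj' hk' rfl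
            rw [h0, factorAt_eq_iff.2 (hf.right_special_unique hb hi hi0 hi1
              (factorAt_eq_iff.1 h2.symm) h0 (by simpa using h3))]
          · exact .inr ⟨_, ⟨k, rfl⟩, by simp only [e, if_pos h, h1]⟩
        · refine .inr ⟨_, ⟨k, rfl⟩, ?_⟩
          simp only [e, if_neg h]
          rcases hb (k + n) with h0 | h1
          · rw [h0]
          · exact absurd ⟨k, by simp only [factorAt_succ, h1]⟩ h
      · rintro (rfl | ⟨u, ⟨k, rfl⟩, rfl⟩)
        · exact ⟨i, by simp only [factorAt_succ, hi0]⟩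
        · by_cases h : factorAt f k n ++ [1] ∈ Set.range fun i => factorAt f i (n + 1)
          · simpa only [e, if_pos h] using h
          · simp only [e, if_neg h]
            rcases hb (k + n) with h0 | h1
            · exact ⟨k, by simp only [factorAt_succ, h0]⟩
            · exact absurd ⟨k, by simp only [factorAt_succ, h1]⟩ h
    have hnot : factorAt f i n ++ [0] ∉
        (fun u => u ++ [e u]) '' Set.range fun i => factorAt f i n := by
      rintro ⟨u, -, hu⟩
      obtain ⟨rfl, h2⟩ := List.append_inj' hu rfl
      simp only [e, if_pos hmem] at h2
      simp at h2
    rw [hR]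
    exact ⟨(hfin.image _).insert _, by
      rw [Set.ncard_insert_of_notMem hnot (hfin.image _), Set.ncard_image_of_injective _ hinj,
        hcard]⟩

section Abelian

variable {β : Type*} {w : ℕ → β}

/-- The abelian class of the factor of length `N` at position `i`. -/
def abel (w : ℕ → β) (N i : ℕ) : Multiset β := (factorAt w i N : Multiset β)

@[simp] lemma card_abel (N i : ℕ) : (abel w N i).card = N := by simp [abel]

lemma abel_one (i : ℕ) : abel w 1 i = {w i} := by simp [abel, factorAt]

lemma abel_succ (N i : ℕ) : abel w (N + 1) i = w (i + N) ::ₘ abel w N i := by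
  rw [abel, factorAt_succ, abel, ← Multiset.coe_add, add_comm, Multiset.coe_singleton,
    Multiset.singleton_add]

lemma abel_succ' (N i : ℕ) : abel w (N + 1) i = w i ::ₘ abel w N (i + 1) := by
  simp [abel, factorAt, List.range_succ_eq_map, Function.comp_def, add_assoc, add_comm 1]

lemma abel_step_iff (N i : ℕ) : abel w N (i + 1) = abel w N i ↔ w (i + N) = w i := by
  have h := (abel_succ (w := w) N i).symm.trans (abel_succ' N i)
  constructor
  · intro h1
    rw [h1] at h
    exact (Multiset.cons_inj_left _).1 h
  · intro h1
    rw [h1] at h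
    exact ((Multiset.cons_inj_right _).1 h).symm

lemma mem_of_mem_abel {N i : ℕ} {x : β} (h : x ∈ abel w N i) : x ∈ Set.range w := by
  simp only [abel, factorAt, Multiset.mem_coe, List.mem_map] at h
  obtain ⟨t, -, h⟩ := h
  exact ⟨_, h⟩

lemma count_abel [DecidableEq β] {x : β} (hf : ∀ i, f i = if w i = x then 1 else 0) (N i : ℕ) :
    ((abel w N i).count x : ℤ) = win f N i := by
  induction N with
  | zero => simp [abel, factorAt, win]
  | succ N ih =>
    have h1 : win f (N + 1) i = win f N i + f (i + N) := by
      simp only [win, ← add_assoc, pre_succ]; ring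
    rw [abel_succ, Multiset.count_cons, h1, ← ih, hf]
    push_cast
    simp only [eq_comm]

lemma abelianReturnClasses_factorAt (i₀ N : ℕ) :
    abelianReturnClasses w (factorAt w i₀ N) =
      {m | ∃ i d, Gap (abel w N) i d ∧ abel w N i = abel w N i₀ ∧ m = abel w d i} := by
  have hocc : ∀ i, i ∈ AbelianOccurrences w (factorAt w i₀ N) ↔ abel w N i = abel w N i₀ := by
    intro i
    simp [AbelianOccurrences, abel]
  ext m
  constructor
  · rintro ⟨_, ⟨i, j, hi, hj, hij, hk, rfl⟩, rfl⟩
    rw [hocc] at hi hj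
    refine ⟨i, j - i, ⟨by omega, ?_, fun k h1 h2 => ?_⟩, hi, rfl⟩
    · rw [show i + (j - i) = j by omega, hi, hj]
    · have := hk k h1 (by omega)
      rwa [hocc, ← hi] at this
  · rintro ⟨i, d, ⟨hd, h1, h2⟩, hi, rfl⟩
    refine ⟨_, ⟨i, i + d, (hocc i).2 hi, (hocc _).2 (h1.trans hi), by omega, fun k h3 h4 => ?_,
      rfl⟩, by simp [abel]⟩
    rw [hocc, ← hi]
    exact h2 k h3 h4

lemma abelianReturnClasses_nil :
    abelianReturnClasses w [] = (fun x => ({x} : Multiset β)) '' Set.range w := by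
  have h0 : ∀ i, abel w 0 i = 0 := fun i => by simp [abel, factorAt]
  rw [show ([] : List β) = factorAt w 0 0 by simp [factorAt], abelianReturnClasses_factorAt]
  ext m
  constructor
  · rintro ⟨i, d, ⟨hd, -, h⟩, -, rfl⟩
    obtain rfl : d = 1 := by
      by_contra hne
      exact h (i + 1) (by omega) (by omega) (by rw [h0, h0])
    exact ⟨w i, ⟨i, rfl⟩, (abel_one i).symm⟩
  · rintro ⟨_, ⟨i, rfl⟩, rfl⟩
    exact ⟨i, 1, ⟨one_pos, by rw [h0, h0], fun k h1 h2 => by omega⟩, by rw [h0, h0],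
      (abel_one i).symm⟩

lemma encard_abelianReturnClasses_nil :
    (abelianReturnClasses w []).encard = (Set.range w).encard := by
  rw [abelianReturnClasses_nil]
  exact Function.Injective.encard_image (fun _ _ => Multiset.singleton_inj.1) _

lemma exists_recurrence (hrec : Recurrent w) (i n M : ℕ) :
    ∃ j, M ≤ j ∧ ∀ t < n, w (j + t) = w (i + t) := by
  obtain ⟨j, hj, h⟩ := hrec _ (isFactor_factorAt w i n) M
  rw [length_factorAt] at h
  exact ⟨j, hj, factorAt_eq_iff.1 h⟩

lemma abel_congr {N i j : ℕ} (h : ∀ t < N, w (i + t) = w (j + t)) : abel w N i = abel w N j := by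
  rw [abel, factorAt_eq_iff.2 h, abel]

/-- A recurrent word on three letters in which every factor has at most three abelian returns is
periodic. -/
lemma periodic_of_three_letters (hrec : Recurrent w) (h3 : (Set.range w).encard = 3)
    (h : ∀ u : List β, IsFactor w u → (abelianReturnClasses w u).encard ≤ 3) : Periodic w := by
  obtain ⟨x, y, z, hxy, hxz, hyz, hr⟩ := Set.encard_eq_three.1 h3
  obtain ⟨i, hi⟩ : x ∈ Set.range w := by simp [hr]
  obtain ⟨j, hj⟩ : y ∈ Set.range w := by simp [hr]
  obtain ⟨k, hk⟩ : z ∈ Set.range w := by simp [hr]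
  obtain ⟨N, hN, hw⟩ := exists_recurrence hrec 0 (i + j + k + 1) 1
  simp only [zero_add] at hw
  have hle := h _ (isFactor_factorAt w 0 N)
  have hocc : ∀ t ≤ i + j + k + 1, abel w N t = abel w N 0 := by
    intro t
    induction t with
    | zero => simp
    | succ t ih =>
      intro ht
      rw [← ih (by omega), abel_step_iff, add_comm, hw t (by omega)]
  have hsub : (fun x => ({x} : Multiset β)) '' Set.range w ⊆
      abelianReturnClasses w (factorAt w 0 N) := by
    have hmem : ∀ t < i + j + k + 1, ({w t} : Multiset β) ∈
        abelianReturnClasses w (factorAt w 0 N) := by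
      intro t ht
      rw [abelianReturnClasses_factorAt]
      exact ⟨t, 1, ⟨one_pos, (hocc (t + 1) (by omega)).trans (hocc t (by omega)).symm,
        fun k h1 h2 => by omega⟩, hocc _ (by omega), (abel_one t).symm⟩
    rintro _ ⟨v, hv, rfl⟩
    rw [hr] at hv
    rcases hv with rfl | rfl | rfl
    · rw [← hi]; exact hmem i (by omega)
    · rw [← hj]; exact hmem j (by omega)
    · rw [← hk]; exact hmem k (by omega)
  have hcard : ((fun x => ({x} : Multiset β)) '' Set.range w).encard = 3 := by
    rw [← abelianReturnClasses_nil, encard_abelianReturnClasses_nil, h3]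
  have heq := Set.Finite.eq_of_subset_of_encard_le
    (Set.finite_of_encard_le_coe (k := 3) hcard.le) hsub (by rw [hcard]; exact hle)
  have hall : ∀ t, abel w N t = abel w N 0 ∧ w (t + N) = w t := by
    have hstep : ∀ t, abel w N t = abel w N 0 → w (t + N) = w t := by
      intro t ht
      obtain ⟨s, hs, hs'⟩ := exists_recurrence hrec t N (t + 1)
      obtain ⟨d, hd⟩ := exists_gap (g := abel w N) ⟨s, hs, abel_congr hs'⟩
      have hm : abel w d t ∈ abelianReturnClasses w (factorAt w 0 N) := by
        rw [abelianReturnClasses_factorAt]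
        exact ⟨t, d, hd, ht, rfl⟩
      rw [← heq] at hm
      obtain ⟨v, -, hv⟩ := hm
      obtain rfl : d = 1 := by
        have := congrArg Multiset.card hv
        simpa using this.symm
      exact (abel_step_iff N t).1 hd.2.1
    intro t
    induction t with
    | zero => exact ⟨rfl, hstep 0 rfl⟩
    | succ t ih =>
      have := ((abel_step_iff N t).2 ih.2).trans ih.1
      exact ⟨this, hstep _ this⟩
  exact ⟨N, hN, fun n => (hall n).2⟩

lemma Gap.congr {γ : Type*} {g : ℕ → β} {g' : ℕ → γ} (h : ∀ i j, g i = g j ↔ g' i = g' j)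
    {i d : ℕ} : Gap g i d ↔ Gap g' i d := by
  simp only [Gap, ne_eq, h]

/-- The indicator word of a letter of a recurrent aperiodic binary word. -/
lemma good_of_two_letters [DecidableEq β] {a b : β} (hab : a ≠ b) (hr : ∀ i, w i = a ∨ w i = b)
    (hf : ∀ i, f i = if w i = b then 1 else 0) (hap : Aperiodic w) (hrec : Recurrent w)
    (h : ∀ u : List β, IsFactor w u → (abelianReturnClasses w u).encard ≤ 3) : Good f := by
  have hfw : ∀ i j, f i = f j ↔ w i = w j := by
    intro i j
    rw [hf, hf]
    rcases hr i with h1 | h1 <;> rcases hr j with h2 | h2 <;> simp [h1, h2, hab, hab.symm]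
  have hfl : ∀ i, BinWord.flip f i = if w i = a then 1 else 0 := by
    intro i
    rw [BinWord.flip, hf]
    rcases hr i with h1 | h1 <;> simp [h1, hab, hab.symm]
  have habel : ∀ N i j, abel w N i = abel w N j ↔ win f N i = win f N j := by
    intro N i j
    rw [← count_abel hf, ← count_abel hf]
    refine ⟨fun h => by rw [h], fun h => Multiset.ext.2 fun x => ?_⟩
    rcases eq_or_ne x b with rfl | hb
    · exact_mod_cast h
    rcases eq_or_ne x a with rfl | ha
    · have h1 := count_abel hfl N i
      have h2 := count_abel hfl N j
      rw [win_flip, ← count_abel hf] at h1 h2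
      omega
    · have hx : ∀ i, (abel w N i).count x = 0 := fun i => Multiset.count_eq_zero.2 fun hm => by
        obtain ⟨t, rfl⟩ := mem_of_mem_abel hm
        exact (hr t).elim ha hb
      rw [hx, hx]
  refine ⟨fun n => ?_, fun N c => ?_, fun i n M => ?_, ?_⟩
  · rw [hf]
    split_ifs <;> simp
  · rcases (retVecs f N c).eq_empty_or_nonempty with h0 | ⟨_, i₀, -, hc, -⟩
    · simp [h0]
    · refine le_trans (Set.encard_le_encard ?_) ((Set.encard_image_le
        (fun m : Multiset β => (m.card, (m.count b : ℤ))) _).trans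
        (h _ (isFactor_factorAt w i₀ N)))
      rintro ⟨d, p⟩ ⟨i, h1, h2, h3⟩
      refine ⟨abel w d i, ?_, ?_⟩
      · rw [abelianReturnClasses_factorAt]
        exact ⟨i, d, (Gap.congr (habel N)).2 h1, (habel N _ _).2 (h2.trans hc.symm), rfl⟩
      · simp only [card_abel, count_abel hf, win, Prod.mk.injEq, true_and]
        exact h3.symm
  · simpa only [hfw] using exists_recurrence hrec i n M
  · rintro ⟨M, T, hT, hp⟩
    refine hap ⟨T, hT, fun n => ?_⟩
    obtain ⟨j, hj, h1⟩ := exists_recurrence hrec n (T + 1) M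
    have h2 := (hfw _ _).1 (hp j hj)
    rw [← h1 T (by omega), h2]
    exact h1 0 (by omega)

lemma ncard_factors_of_indicator (hfw : ∀ i j, f i = f j ↔ w i = w j) (n : ℕ) :
    {u : List β | u.length = n ∧ IsFactor w u}.ncard =
      (Set.range fun i => factorAt f i n).ncard := by
  rw [setOf_isFactor]
  refine Set.ncard_congr (fun u hu => factorAt f hu.choose n) (fun u hu => ⟨_, rfl⟩)
    (fun u v hu hv h => ?_) ?_
  · rw [← hu.choose_spec, ← hv.choose_spec]
    simp only [factorAt_eq_iff] at h ⊢
    exact fun t ht => (hfw _ _).1 (h t ht)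
  · rintro _ ⟨i, rfl⟩
    have hi : factorAt w i n ∈ Set.range fun i => factorAt w i n := ⟨i, rfl⟩
    refine ⟨_, hi, factorAt_eq_iff.2 fun t ht => (hfw _ _).2 ?_⟩
    exact factorAt_eq_iff.1 hi.choose_spec t ht

end Abelian

end BinWord

/-- Sufficiency. If each factor of an aperiodic recurrent infinite word
has two or three abelian returns, then the word is Sturmian. -/
theorem sturmian_of_two_or_three_abelian_returns {α : Type*} [Fintype α]
    (w : ℕ → α) (hap : Aperiodic w) (hrec : Recurrent w)
    (h : ∀ u : List α, IsFactor w u →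
      (abelianReturnClasses w u).encard = 2 ∨ (abelianReturnClasses w u).encard = 3) :
    Sturmian w := by
  classical
  have hle : ∀ u : List α, IsFactor w u → (abelianReturnClasses w u).encard ≤ 3 := by
    intro u hu
    rcases h u hu with h1 | h1
    · rw [h1]; decide
    · rw [h1]
  have h0 := h [] ⟨0, by simp [factorAt]⟩
  rw [BinWord.encard_abelianReturnClasses_nil] at h0
  rcases h0 with h2 | h3
  swap
  · exact absurd (BinWord.periodic_of_three_letters hrec h3 hle) hap
  obtain ⟨a, b, hab, hr⟩ := Set.encard_eq_two.1 h2
  have hr : ∀ i, w i = a ∨ w i = b := fun i => by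
    have : w i ∈ Set.range w := ⟨i, rfl⟩
    rwa [hr] at this
  let f : ℕ → ℤ := fun i => if w i = b then 1 else 0
  have hf : BinWord.Good f := BinWord.good_of_two_letters hab hr (fun _ => rfl) hap hrec hle
  refine ⟨hap, fun n => ?_⟩
  rw [BinWord.ncard_factors_of_indicator (f := f) fun i j => ?_]
  · exact (hf.balanced.complexity hf.bin hf.not_ultPer n).2
  · simp only [f]
    rcases hr i with h1 | h1 <;> rcases hr j with h2 | h2 <;> simp [h1, h2, hab, hab.symm]
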